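/- arXiv:2411.00798 — 4 statements merged into one kernel-verified Lean document; each statement's English description precedes it below -/
import Mathlib

section
/- The algebra D(W_H) is commutative: if 𝔇 (with matrix polynomial coefficients F_0, …, F_n) and 𝔈 (with matrix polynomial coefficients H_0, …, H_m) are differential operators such that for every k ≥ 0 there exist Λ_k, M_k ∈ Mat_N(ℂ) with P_k·𝔇 = Λ_k P_k and P_k·𝔈 = M_k P_k, where {P_k} is a sequence of monic orthogonal polynomials for W_H, then for every P ∈ Mat_N(ℂ[x]) one has (P·𝔇)·𝔈 = (P·𝔈)·𝔇. -/
open Polynomial MeasureTheory Matrix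

noncomputable section

abbrev Mat (N : ℕ) := Matrix (Fin N) (Fin N) ℂ

/-- The matrix unit with a `1` in the (1-indexed) entry `(s, t)` and `0` elsewhere. -/
def EU (N : ℕ) (s t : ℕ) : Mat N :=
  Matrix.of fun p q => if (p : ℕ) + 1 = s ∧ (q : ℕ) + 1 = t then 1 else 0

/-- Evaluation of a matrix polynomial at a real point. -/
def mval {N : ℕ} (P : Polynomial (Mat N)) (x : ℝ) : Mat N :=
  Polynomial.eval ((x : ℂ) • (1 : Mat N)) P

/-- The nilpotent matrix `A = Σ a_{2j-1} E_{2j-1,2j} + Σ a_{2j} E_{2j+1,2j}`. -/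
def Amat (N : ℕ) (a : ℕ → ℝ) : Mat N :=
  (∑ j ∈ Finset.Icc 1 (N / 2), (a (2 * j - 1) : ℂ) • EU N (2 * j - 1) (2 * j)) +
  (∑ j ∈ Finset.Icc 1 ((N - 1) / 2), (a (2 * j) : ℂ) • EU N (2 * j + 1) (2 * j))

/-- `K = Σ_{j=1}^{⌊N/2⌋} E_{2j,2j}`. -/
def Kmat (N : ℕ) : Mat N := ∑ j ∈ Finset.Icc 1 (N / 2), EU N (2 * j) (2 * j)

/-- `T(x) = I + x A`. -/
def Tmat (N : ℕ) (a : ℕ → ℝ) (x : ℝ) : Mat N := 1 + (x : ℂ) • Amat N a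

/-- The diagonal Hermite weight `diag(e^{-x²+2b₁x}, …, e^{-x²+2b_Nx})` (1-indexed `b`). -/
def hermiteDiag (N : ℕ) (b : ℕ → ℝ) (x : ℝ) : Mat N :=
  Matrix.diagonal fun i => (Real.exp (-x ^ 2 + 2 * b ((i : ℕ) + 1) * x) : ℂ)

/-- The Hermite-type weight `W_H(x) = T(x) · diag(…) · T(x)^*`. -/
def WH (N : ℕ) (a b : ℕ → ℝ) (x : ℝ) : Mat N :=
  Tmat N a x * hermiteDiag N b x * (Tmat N a x)ᴴ

/-- The right action `P·𝔇 = Σ_{j=0}^n P^{(j)} F_j` of a differential operator with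
matrix-polynomial coefficients `F_0, …, F_n`. -/
def applyOp {N : ℕ} (F : ℕ → Polynomial (Mat N)) (n : ℕ) (P : Polynomial (Mat N)) :
    Polynomial (Mat N) :=
  ∑ j ∈ Finset.range (n + 1), (fun Q : Polynomial (Mat N) => derivative Q)^[j] P * F j

lemma integrable_eval_mul_gaussian (b : ℝ) (p : ℂ[X]) :
    Integrable (fun x : ℝ => p.eval (x : ℂ) * (Real.exp (-x ^ 2 + 2 * b * x) : ℂ)) := by
  have key : ∀ q : ℂ[X], Integrable (fun x : ℝ => q.eval (x : ℂ) * (Real.exp (-x ^ 2) : ℂ)) := by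
    intro q
    induction q using Polynomial.induction_on' with
    | add p q hp hq =>
      refine (hp.add hq).congr (Filter.Eventually.of_forall fun x => ?_)
      simp [add_mul]
    | monomial n a =>
      have h := (integrable_rpow_mul_exp_neg_mul_sq (b := 1) one_pos (s := n)
        (by have : (0 : ℝ) ≤ n := n.cast_nonneg
            linarith)).ofReal (𝕜 := ℂ) |>.const_mul a
      refine h.congr (Filter.Eventually.of_forall fun x => ?_)
      simp [mul_assoc]
  have h := ((key (p.comp (X + C (b : ℂ)))).comp_sub_right b).mul_const (Real.exp (b ^ 2) : ℂ)
  refine h.congr (Filter.Eventually.of_forall fun x => ?_)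
  simp only [eval_comp, eval_add, eval_X, eval_C, mul_assoc]
  have e : -x ^ 2 + 2 * (b * x) = -(x - b) ^ 2 + b ^ 2 := by ring
  rw [← Complex.ofReal_mul, ← Real.exp_add, e]
  simp

/-- The moment functional of the scalar Hermite weight `e^{-x² + 2bx}`. -/
def hermiteFunctional (b : ℝ) : ℂ[X] →ₗ[ℂ] ℂ where
  toFun p := ∫ x : ℝ, p.eval (x : ℂ) * (Real.exp (-x ^ 2 + 2 * b * x) : ℂ)
  map_add' p q := by
    rw [← integral_add (integrable_eval_mul_gaussian b p) (integrable_eval_mul_gaussian b q)]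
    simp [add_mul]
  map_smul' c p := by
    rw [RingHom.id_apply, smul_eq_mul, ← integral_const_mul]
    simp [mul_assoc]

lemma hermiteFunctional_apply (b : ℝ) (p : ℂ[X]) :
    hermiteFunctional b p = ∫ x : ℝ, p.eval (x : ℂ) * (Real.exp (-x ^ 2 + 2 * b * x) : ℂ) := rfl

lemma hermiteFunctional_derivative (b : ℝ) (p : ℂ[X]) :
    hermiteFunctional b (derivative p + (C (2 * b : ℂ) - 2 * X) * p) = 0 := by
  rw [hermiteFunctional_apply]
  refine integral_eq_zero_of_hasDerivAt_of_integrable (fun x => ?_)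
    (integrable_eval_mul_gaussian b _) (integrable_eval_mul_gaussian b p)
  have h1 : HasDerivAt (fun x : ℝ => p.eval (x : ℂ)) ((derivative p).eval (x : ℂ)) x :=
    (p.hasDerivAt (x : ℂ)).comp_ofReal
  have h2 : HasDerivAt (fun x : ℝ => Real.exp (-x ^ 2 + 2 * b * x))
      (Real.exp (-x ^ 2 + 2 * b * x) * (-(2 * x) + 2 * b)) x := by
    refine HasDerivAt.exp ?_
    refine HasDerivAt.add ?_ ?_
    · simpa using (hasDerivAt_pow 2 x).fun_neg
    · simpa using (hasDerivAt_id x).const_mul (2 * b)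
  refine (h1.mul h2.ofReal_comp).congr_deriv ?_
  simp only [eval_add, eval_mul, eval_sub, eval_C, eval_X, eval_ofNat]
  push_cast
  ring

/-- Coefficientwise complex conjugation of a polynomial. -/
def conjPoly : ℂ[X] →+* ℂ[X] := Polynomial.mapRingHom (starRingEnd ℂ)

lemma conjPoly_conjPoly (p : ℂ[X]) : conjPoly (conjPoly p) = p := by
  simp [conjPoly, Polynomial.map_map]

lemma eval_conjPoly (p : ℂ[X]) (x : ℝ) :
    (conjPoly p).eval (x : ℂ) = star (p.eval (x : ℂ)) := by
  have := Polynomial.eval_map_apply (starRingEnd ℂ) (p := p) (x : ℂ)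
  simpa [conjPoly] using this

lemma hermiteFunctional_mul_conj (b : ℝ) (p : ℂ[X]) :
    hermiteFunctional b (p * conjPoly p) =
      ((∫ x : ℝ, ‖p.eval (x : ℂ)‖ ^ 2 * Real.exp (-x ^ 2 + 2 * b * x) : ℝ) : ℂ) := by
  rw [hermiteFunctional_apply, ← integral_complex_ofReal]
  congr 1
  ext x
  rw [eval_mul, eval_conjPoly]
  have := Complex.mul_conj' (p.eval (x : ℂ))
  simp only [Complex.star_def, this]
  push_cast
  rfl

lemma integral_norm_sq_nonneg (b : ℝ) (p : ℂ[X]) :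
    0 ≤ ∫ x : ℝ, ‖p.eval (x : ℂ)‖ ^ 2 * Real.exp (-x ^ 2 + 2 * b * x) :=
  integral_nonneg fun x => by positivity

lemma eq_zero_of_integral_norm_sq (b : ℝ) (p : ℂ[X])
    (h : ∫ x : ℝ, ‖p.eval (x : ℂ)‖ ^ 2 * Real.exp (-x ^ 2 + 2 * b * x) = 0) : p = 0 := by
  have hint : Integrable (fun x : ℝ => ‖p.eval (x : ℂ)‖ ^ 2 * Real.exp (-x ^ 2 + 2 * b * x)) := by
    refine (integrable_eval_mul_gaussian b (p * conjPoly p)).re.congr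
      (Filter.Eventually.of_forall fun x => ?_)
    have := Complex.mul_conj' (p.eval (x : ℂ))
    simp only [eval_mul, eval_conjPoly, Complex.star_def, this]
    rw [← Complex.ofReal_pow, ← Complex.ofReal_mul]
    rfl
  rw [integral_eq_zero_iff_of_nonneg (fun x => by positivity) hint] at h
  have hc : Continuous
      (fun x : ℝ => ‖p.eval (x : ℂ)‖ ^ 2 * Real.exp (-x ^ 2 + 2 * b * x)) := by
    have : Continuous fun x : ℝ => p.eval (x : ℂ) := p.continuous.comp Complex.continuous_ofReal
    fun_prop
  have h0 := (Continuous.ae_eq_iff_eq volume hc continuous_zero).1 h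
  refine Polynomial.eq_zero_of_infinite_isRoot p
    ((Set.infinite_range_of_injective Complex.ofReal_injective).mono ?_)
  rintro _ ⟨x, rfl⟩
  have := congrFun h0 x
  simpa [Real.exp_ne_zero] using this

lemma eq_zero_of_hermiteFunctional_mul (b : ℝ) (r : ℂ[X])
    (h : ∀ p, hermiteFunctional b (p * r) = 0) : r = 0 := by
  have h1 := h (conjPoly r)
  rw [mul_comm, hermiteFunctional_mul_conj] at h1
  exact eq_zero_of_integral_norm_sq b r (by exact_mod_cast h1)

lemma eq_zero_of_derivative_add_mul {c : ℂ} (hc : c ≠ 0) {f : ℂ[X]}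
    (h : derivative f + C c * f = 0) : f = 0 := by
  by_contra hf
  have h1 := congrArg (fun q => q.coeff f.natDegree) h
  simp only [coeff_add, coeff_C_mul, coeff_zero, coeff_derivative] at h1
  rw [coeff_eq_zero_of_natDegree_lt (Nat.lt_succ_self _)] at h1
  simp [hc, hf] at h1

lemma eq_zero_of_hermiteFunctional_eq {b b' : ℝ} (hb : b ≠ b') (n : ℕ) (f g : ℂ[X])
    (hg : g.degree < n)
    (h : ∀ p, hermiteFunctional b' (f * p) = hermiteFunctional b (g * p)) : f = 0 := by
  induction n generalizing f g with
  | zero =>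
    have hg0 : g = 0 := by simpa using hg
    exact eq_zero_of_hermiteFunctional_mul b' f fun p => by rw [mul_comm, h p, hg0]; simp
  | succ n ih =>
    have hc : (2 * b' - 2 * b : ℂ) ≠ 0 := by
      intro h0
      apply hb
      have : (b' : ℂ) = b := by linear_combination h0 / 2
      exact_mod_cast this.symm
    refine eq_zero_of_derivative_add_mul hc (ih _ (derivative g) ?_ fun p => ?_)
    · rw [degree_lt_iff_coeff_zero] at hg ⊢
      intro m hm
      rw [coeff_derivative, hg (m + 1) (by omega), zero_mul]
    · have h1 := hermiteFunctional_derivative b' (f * p)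
      have h2 := hermiteFunctional_derivative b (g * p)
      have h3 := h (derivative p + (C (2 * b : ℂ) - 2 * X) * p)
      have e1 : (derivative f + C (2 * b' - 2 * b : ℂ) * f) * p =
          (derivative (f * p) + (C (2 * b' : ℂ) - 2 * X) * (f * p)) -
            f * (derivative p + (C (2 * b : ℂ) - 2 * X) * p) := by
        rw [derivative_mul, C_sub]; ring
      have e2 : derivative g * p =
          (derivative (g * p) + (C (2 * b : ℂ) - 2 * X) * (g * p)) -
            g * (derivative p + (C (2 * b : ℂ) - 2 * X) * p) := by
        rw [derivative_mul]; ring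
      rw [e1, e2, map_sub, map_sub, h1, h2, h3]

/-- The commutator of a linear operator on polynomials with multiplication by `X`. -/
def commX (A : ℂ[X] →ₗ[ℂ] ℂ[X]) : ℂ[X] →ₗ[ℂ] ℂ[X] :=
  A ∘ₗ LinearMap.mulLeft ℂ X - LinearMap.mulLeft ℂ X ∘ₗ A

lemma commX_apply (A : ℂ[X] →ₗ[ℂ] ℂ[X]) (p : ℂ[X]) : commX A p = A (X * p) - X * A p := rfl

lemma eq_mul_of_commX_eq_zero {A : ℂ[X] →ₗ[ℂ] ℂ[X]} (h : commX A = 0) (p : ℂ[X]) :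
    A p = A 1 * p := by
  have hX : ∀ p, A (X * p) = X * A p := fun p => by
    rw [← sub_eq_zero, ← commX_apply, h]; rfl
  have hpow : ∀ k : ℕ, A (X ^ k) = A 1 * X ^ k := by
    intro k
    induction k with
    | zero => simp
    | succ k ih => rw [pow_succ', hX, ih]; ring
  induction p using Polynomial.induction_on' with
  | add p q hp hq => rw [map_add, hp, hq, mul_add]
  | monomial n a => rw [← smul_X_eq_monomial, map_smul, hpow, mul_smul_comm]

lemma eq_zero_of_adjoint {b b' : ℝ} (hb : b ≠ b') (k : ℕ) (A : ℂ[X] →ₗ[ℂ] ℂ[X])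
    (hA : commX^[k] A = 0)
    (hadj : ∀ q, ∃ r, ∀ p, hermiteFunctional b' (A p * q) = hermiteFunctional b (p * r)) :
    A = 0 := by
  induction k generalizing A with
  | zero => exact hA
  | succ k ih =>
    have h0 : commX A = 0 := by
      refine ih (commX A) hA fun q => ?_
      obtain ⟨r, hr⟩ := hadj q
      obtain ⟨r', hr'⟩ := hadj (X * q)
      refine ⟨X * r - r', fun p => ?_⟩
      have e : commX A p * q = A (X * p) * q - A p * (X * q) := by rw [commX_apply]; ring
      rw [e, map_sub, hr, hr', ← map_sub]
      congr 1; ring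
    have hmul := eq_mul_of_commX_eq_zero h0
    obtain ⟨r, hr⟩ := hadj 1
    have hf : A 1 = 0 := by
      refine eq_zero_of_hermiteFunctional_eq hb (r.natDegree + 1) (A 1) r ?_ fun p => ?_
      · exact_mod_cast degree_le_natDegree.trans_lt (by exact_mod_cast Nat.lt_succ_self _)
      · rw [← hmul, mul_comm r]; simpa using hr p
    exact LinearMap.ext fun p => by rw [hmul, hf, zero_mul, LinearMap.zero_apply]

/-- The truncated right action `∑_{j < k} P^{(j)} F_j`. -/
def opSum {N : ℕ} (F : ℕ → (Mat N)[X]) (k : ℕ) (P : (Mat N)[X]) : (Mat N)[X] :=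
  ∑ j ∈ Finset.range k, derivative^[j] P * F j

lemma opSum_add {N : ℕ} (F : ℕ → (Mat N)[X]) (k : ℕ) (P Q : (Mat N)[X]) :
    opSum F k (P + Q) = opSum F k P + opSum F k Q := by
  simp [opSum, iterate_map_add, add_mul, Finset.sum_add_distrib]

lemma opSum_C_mul {N : ℕ} (F : ℕ → (Mat N)[X]) (k : ℕ) (M : Mat N) (P : (Mat N)[X]) :
    opSum F k (C M * P) = C M * opSum F k P := by
  simp only [opSum, iterate_derivative_C_mul, Finset.mul_sum, mul_assoc]

lemma opSum_zero {N : ℕ} (F : ℕ → (Mat N)[X]) (k : ℕ) : opSum F k 0 = 0 := by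
  simpa using opSum_C_mul F k 0 0

lemma iterate_derivative_succ_X_mul {R : Type*} [Semiring R] (n : ℕ) (p : R[X]) :
    derivative^[n + 1] (X * p) = X * derivative^[n + 1] p + (n + 1) • derivative^[n] p := by
  induction n with
  | zero => simp [derivative_mul, add_comm]
  | succ n ih =>
    rw [Function.iterate_succ_apply', ih, derivative_add, derivative_mul, derivative_X, one_mul,
      derivative_smul, ← Function.iterate_succ_apply' derivative,
      ← Function.iterate_succ_apply' derivative, succ_nsmul _ (n + 1)]
    abel

lemma opSum_X_mul {N : ℕ} (F : ℕ → (Mat N)[X]) (k : ℕ) (P : (Mat N)[X]) :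
    opSum F (k + 1) (X * P) =
      X * opSum F (k + 1) P + opSum (fun j => (j + 1) • F (j + 1)) k P := by
  simp only [opSum, Finset.sum_range_succ' _ k, iterate_derivative_succ_X_mul, add_mul, mul_add,
    Finset.mul_sum, Finset.sum_add_distrib, Function.iterate_zero_apply, mul_assoc,
    smul_mul_assoc, mul_smul_comm]
  abel

/-- Matrices with polynomial entries. -/
abbrev PolyMat (N : ℕ) := Matrix (Fin N) (Fin N) ℂ[X]

/-- A matrix polynomial, viewed as a matrix with polynomial entries. -/
abbrev toPolyMat {N : ℕ} : (Mat N)[X] ≃ₐ[ℂ] PolyMat N := matPolyEquiv.symm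

lemma toPolyMat_symm_X_smul {N : ℕ} (U : PolyMat N) :
    toPolyMat.symm ((X : ℂ[X]) • U) = X * toPolyMat.symm U := by
  simp [toPolyMat]

lemma toPolyMat_C_mul {N : ℕ} (M : Mat N) (P : (Mat N)[X]) :
    toPolyMat (C M * P) = M.map C * toPolyMat P := by
  simp [toPolyMat]

lemma toPolyMat_symm_map_C_mul {N : ℕ} (M : Mat N) (U : PolyMat N) :
    toPolyMat.symm (M.map C * U) = C M * toPolyMat.symm U := by
  simp [toPolyMat]

/-- The operator `opSum F k` conjugated by `T`, where `S` plays the role of `T⁻¹`. -/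
def conjOp {N : ℕ} (T S : PolyMat N) (F : ℕ → (Mat N)[X]) (k : ℕ) (U : PolyMat N) : PolyMat N :=
  toPolyMat (opSum F k (toPolyMat.symm (U * S))) * T

section conjOp

variable {N : ℕ} (T S : PolyMat N) (F : ℕ → (Mat N)[X]) (k : ℕ)

lemma conjOp_add (U V : PolyMat N) :
    conjOp T S F k (U + V) = conjOp T S F k U + conjOp T S F k V := by
  simp only [conjOp, add_mul, map_add, opSum_add]

lemma conjOp_map_C_mul (M : Mat N) (U : PolyMat N) :
    conjOp T S F k (M.map C * U) = M.map C * conjOp T S F k U := by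
  simp only [conjOp, mul_assoc, toPolyMat_symm_map_C_mul, opSum_C_mul, toPolyMat_C_mul]

lemma conjOp_zero : conjOp T S F k 0 = 0 := by
  simp [conjOp, opSum_zero]

lemma conjOp_sum {ι : Type*} (s : Finset ι) (U : ι → PolyMat N) :
    conjOp T S F k (∑ i ∈ s, U i) = ∑ i ∈ s, conjOp T S F k (U i) :=
  map_sum (AddMonoidHom.mk' (conjOp T S F k) (conjOp_add T S F k)) U s

lemma conjOp_smul (c : ℂ) (U : PolyMat N) :
    conjOp T S F k (c • U) = c • conjOp T S F k U := by
  have h : ∀ V : PolyMat N, c • V = (Matrix.scalar (Fin N) c).map C * V := fun V => by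
    ext1 i j
    simp [Matrix.diagonal_map, smul_eq_C_mul]
  rw [h, conjOp_map_C_mul, ← h]

lemma conjOp_X_smul (U : PolyMat N) :
    conjOp T S F (k + 1) ((X : ℂ[X]) • U) = (X : ℂ[X]) • conjOp T S F (k + 1) U +
      conjOp T S (fun j => (j + 1) • F (j + 1)) k U := by
  have h : ∀ P : (Mat N)[X], toPolyMat (X * P) = (X : ℂ[X]) • toPolyMat P := fun P => by
    apply toPolyMat.symm.injective
    rw [toPolyMat_symm_X_smul, AlgEquiv.symm_apply_apply, AlgEquiv.symm_apply_apply]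
  simp only [conjOp, Matrix.smul_mul, toPolyMat_symm_X_smul, opSum_X_mul, map_add, add_mul, h]

/-- The `(i, j)` entry of `conjOp T S F k`, an operator on scalar polynomials. -/
def entryOp (i j : Fin N) : ℂ[X] →ₗ[ℂ] ℂ[X] where
  toFun p := conjOp T S F k (Matrix.single i i p) i j
  map_add' p q := by rw [Matrix.single_add, conjOp_add, Matrix.add_apply]
  map_smul' c p := by
    rw [← Matrix.smul_single, conjOp_smul, Matrix.smul_apply, RingHom.id_apply]

lemma entryOp_apply (i j : Fin N) (p : ℂ[X]) :
    entryOp T S F k i j p = conjOp T S F k (Matrix.single i i p) i j := rfl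

lemma commX_entryOp (i j : Fin N) :
    commX (entryOp T S F (k + 1) i j) =
      entryOp T S (fun j => (j + 1) • F (j + 1)) k i j := by
  refine LinearMap.ext fun p => ?_
  have h : Matrix.single i i (X * p) = (X : ℂ[X]) • Matrix.single i i p := by
    rw [Matrix.smul_single, smul_eq_mul]
  rw [commX_apply, entryOp_apply, entryOp_apply, entryOp_apply, h, conjOp_X_smul,
    Matrix.add_apply, Matrix.smul_apply, smul_eq_mul, add_sub_cancel_left]

lemma commX_iterate_entryOp (i j : Fin N) : commX^[k] (entryOp T S F k i j) = 0 := by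
  induction k generalizing F with
  | zero =>
    refine LinearMap.ext fun p => ?_
    simp [entryOp_apply, conjOp, opSum]
  | succ k ih => rw [Function.iterate_succ_apply, commX_entryOp, ih]

lemma conjOp_apply (U : PolyMat N) (s j : Fin N) :
    conjOp T S F k U s j = ∑ i, entryOp T S F k i j (U s i) := by
  have h : ∀ r i : Fin N, Matrix.single r i (U r i) =
      (Matrix.single r i (1 : ℂ)).map C * Matrix.single i i (U r i) := fun r i => by
    rw [Matrix.map_single _ _ _ (C : ℂ →+* ℂ[X]), Matrix.single_mul_single_same]
    simp
  conv_lhs => rw [Matrix.matrix_eq_sum_single U]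
  simp only [conjOp_sum, Matrix.sum_apply]
  rw [Finset.sum_eq_single s]
  · refine Finset.sum_congr rfl fun i _ => ?_
    rw [h, conjOp_map_C_mul, Matrix.map_single _ _ _ (C : ℂ →+* ℂ[X]),
      Matrix.single_mul_apply_same, map_one, one_mul, entryOp_apply]
  · intro r _ hr
    refine Finset.sum_eq_zero fun i _ => ?_
    rw [h, conjOp_map_C_mul, Matrix.map_single _ _ _ (C : ℂ →+* ℂ[X]),
      Matrix.single_mul_apply_of_ne _ _ _ _ _ hr.symm]
  · simp

end conjOp

/-- The matrix-valued sesquilinear form `∫ U diag(e^{-x² + 2βᵢx}) V^*`. -/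
def hermiteForm {N : ℕ} (β : Fin N → ℝ) (U V : PolyMat N) : Mat N :=
  Matrix.of fun s t => ∑ i, hermiteFunctional (β i) (U s i * conjPoly (V t i))

section hermiteForm

variable {N : ℕ} (β : Fin N → ℝ)

lemma hermiteForm_apply (U V : PolyMat N) (s t : Fin N) :
    hermiteForm β U V s t = ∑ i, hermiteFunctional (β i) (U s i * conjPoly (V t i)) := rfl

lemma hermiteForm_add_left (U U' V : PolyMat N) :
    hermiteForm β (U + U') V = hermiteForm β U V + hermiteForm β U' V := by
  ext s t
  simp [hermiteForm_apply, add_mul, Finset.sum_add_distrib]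

lemma hermiteForm_add_right (U V V' : PolyMat N) :
    hermiteForm β U (V + V') = hermiteForm β U V + hermiteForm β U V' := by
  ext s t
  simp [hermiteForm_apply, mul_add, Finset.sum_add_distrib]

lemma hermiteForm_map_C_mul_left (M : Mat N) (U V : PolyMat N) :
    hermiteForm β (M.map C * U) V = M * hermiteForm β U V := by
  ext s t
  simp only [hermiteForm_apply, Matrix.mul_apply, Finset.sum_mul, map_sum, Finset.mul_sum,
    Matrix.map_apply]
  rw [Finset.sum_comm]
  refine Finset.sum_congr rfl fun i _ => Finset.sum_congr rfl fun j _ => ?_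
  rw [mul_assoc, ← smul_eq_C_mul, map_smul, smul_eq_mul]

lemma conjPoly_C (c : ℂ) : conjPoly (C c) = C (star c) := by
  simp [conjPoly]

lemma hermiteForm_map_C_mul_right (M : Mat N) (U V : PolyMat N) :
    hermiteForm β U (M.map C * V) = hermiteForm β U V * Mᴴ := by
  ext s t
  simp only [hermiteForm_apply, Matrix.mul_apply, Finset.sum_mul, map_sum, Finset.mul_sum,
    Matrix.map_apply, Matrix.conjTranspose_apply, map_mul, conjPoly_C]
  rw [Finset.sum_comm]
  refine Finset.sum_congr rfl fun i _ => Finset.sum_congr rfl fun j _ => ?_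
  rw [mul_left_comm, ← smul_eq_C_mul, map_smul, smul_eq_mul, mul_comm]

lemma hermiteForm_zero_left (V : PolyMat N) : hermiteForm β 0 V = 0 := by
  ext s t
  simp [hermiteForm_apply]

lemma hermiteForm_zero_right (U : PolyMat N) : hermiteForm β U 0 = 0 := by
  ext s t
  simp [hermiteForm_apply]

lemma hermiteForm_single_left (i : Fin N) (p : ℂ[X]) (V : PolyMat N) (t : Fin N) :
    hermiteForm β (Matrix.single i i p) V i t =
      hermiteFunctional (β i) (p * conjPoly (V t i)) := by
  rw [hermiteForm_apply, Finset.sum_eq_single i]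
  · simp
  · intro l _ hl
    simp [hl.symm]
  · simp

lemma eq_zero_of_hermiteForm_self (U : PolyMat N) (h : hermiteForm β U U = 0) : U = 0 := by
  ext1 s i
  have h1 : hermiteForm β U U s s = 0 := by rw [h]; rfl
  simp only [hermiteForm_apply, hermiteFunctional_mul_conj] at h1
  rw [← Complex.ofReal_sum, Complex.ofReal_eq_zero,
    Finset.sum_eq_zero_iff_of_nonneg fun i _ => integral_norm_sq_nonneg _ _] at h1
  exact eq_zero_of_integral_norm_sq _ _ (h1 i (Finset.mem_univ i))

variable {β} (T S : PolyMat N) (F : ℕ → (Mat N)[X]) (k : ℕ)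

/-- If `conjOp T S F k` has an adjoint, then its off-diagonal entries vanish. -/
lemma entryOp_eq_zero_of_adjoint (hβ : Function.Injective β)
    (hadj : ∀ V, ∃ R, ∀ U, hermiteForm β (conjOp T S F k U) V = hermiteForm β U R)
    {i j : Fin N} (hij : i ≠ j) : entryOp T S F k i j = 0 := by
  refine eq_zero_of_adjoint (b := β i) (b' := β j) (fun h => hij (hβ h)) k _
    (commX_iterate_entryOp T S F k i j) fun q => ?_
  obtain ⟨R, hR⟩ := hadj (Matrix.single j j (conjPoly q))
  refine ⟨conjPoly (R j i), fun p => ?_⟩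
  have h := congrFun (congrFun (hR (Matrix.single i i p)) i) j
  rw [hermiteForm_single_left, hermiteForm_apply, Finset.sum_eq_single j] at h
  · rw [← h, entryOp_apply]
    simp [conjPoly_conjPoly]
  · intro l _ hl
    simp [hl.symm]
  · simp

lemma conjOp_apply_of_adjoint (hβ : Function.Injective β)
    (hadj : ∀ V, ∃ R, ∀ U, hermiteForm β (conjOp T S F k U) V = hermiteForm β U R)
    (U : PolyMat N) (s j : Fin N) :
    conjOp T S F k U s j = entryOp T S F k j j (U s j) := by
  rw [conjOp_apply, Finset.sum_eq_single j]
  · intro i _ hi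
    rw [entryOp_eq_zero_of_adjoint T S F k hβ hadj hi, LinearMap.zero_apply]
  · simp

lemma adjoint_apply_eq_zero (hβ : Function.Injective β)
    (hadj : ∀ V, ∃ R, ∀ U, hermiteForm β (conjOp T S F k U) V = hermiteForm β U R)
    {V R : PolyMat N} (hR : ∀ U, hermiteForm β (conjOp T S F k U) V = hermiteForm β U R)
    {i j : Fin N} (hV : V i j = 0) : R i j = 0 := by
  have h0 : conjPoly (R i j) = 0 := by
    refine eq_zero_of_hermiteFunctional_mul (β j) _ fun p => ?_
    have h := congrFun (congrFun (hR (Matrix.single j j p)) j) i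
    rw [hermiteForm_single_left] at h
    rw [← h, hermiteForm_apply]
    refine Finset.sum_eq_zero fun l _ => ?_
    rw [conjOp_apply_of_adjoint T S F k hβ hadj]
    rcases eq_or_ne j l with rfl | hl
    · simp [hV]
    · simp [hl]
  rw [← conjPoly_conjPoly (R i j), h0, map_zero]

end hermiteForm

/-- If a relation on matrix polynomials is additive and relates `M P_k` to `M Λ_k P_k` for a
monic sequence `P_k`, then every `Q` is related to some `R` with leading coefficient
`Q_k Λ_k` in degree `k`. -/
lemma exists_rel_of_eigen {N : ℕ} {P : ℕ → (Mat N)[X]} (hdeg : ∀ n, (P n).natDegree = n)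
    (hmonic : ∀ n, (P n).Monic) (Λ : ℕ → Mat N) (Rel : (Mat N)[X] → (Mat N)[X] → Prop)
    (h0 : Rel 0 0) (hadd : ∀ Q R Q' R', Rel Q R → Rel Q' R' → Rel (Q + Q') (R + R'))
    (heig : ∀ k M, Rel (C M * P k) (C (M * Λ k) * P k)) (k : ℕ) (Q : (Mat N)[X])
    (hQ : ∀ m, k < m → Q.coeff m = 0) :
    ∃ R, Rel Q R ∧ (∀ m, k < m → R.coeff m = 0) ∧ R.coeff k = Q.coeff k * Λ k := by
  have hlead : ∀ k, (P k).coeff k = 1 := fun k => by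
    have h := hmonic k
    rwa [Monic, leadingCoeff, hdeg] at h
  have hhigh : ∀ k m, k < m → (P k).coeff m = 0 := fun k m hm =>
    coeff_eq_zero_of_natDegree_lt (by rwa [hdeg])
  have step : ∀ k Q, (∃ R', Rel (Q - C (Q.coeff k) * P k) R' ∧ ∀ m, k ≤ m → R'.coeff m = 0) →
      ∃ R, Rel Q R ∧ (∀ m, k < m → R.coeff m = 0) ∧ R.coeff k = Q.coeff k * Λ k := by
    rintro k Q ⟨R', hR', hc⟩
    refine ⟨R' + C (Q.coeff k * Λ k) * P k, ?_, fun m hm => ?_, ?_⟩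
    · simpa using hadd _ _ _ _ hR' (heig k (Q.coeff k))
    · rw [coeff_add, coeff_C_mul, hc m hm.le, hhigh k m hm, mul_zero, add_zero]
    · rw [coeff_add, coeff_C_mul, hc k le_rfl, hlead, mul_one, zero_add]
  have hsub : ∀ k (Q : (Mat N)[X]), (∀ m, k < m → Q.coeff m = 0) →
      ∀ m, k ≤ m → (Q - C (Q.coeff k) * P k).coeff m = 0 := by
    intro k Q hQ m hm
    rw [coeff_sub, coeff_C_mul]
    rcases hm.eq_or_lt with rfl | hm
    · rw [hlead, mul_one, sub_self]
    · rw [hQ m hm, hhigh k m hm, mul_zero, sub_zero]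
  induction k generalizing Q with
  | zero =>
    have hz : Q - C (Q.coeff 0) * P 0 = 0 := by
      ext1 m
      rw [hsub 0 Q hQ m m.zero_le, coeff_zero]
    exact step 0 Q ⟨0, by rw [hz]; exact h0, fun m _ => coeff_zero m⟩
  | succ k ih =>
    obtain ⟨R, hR, hc, -⟩ := ih _ (fun m hm => hsub (k + 1) Q hQ m hm)
    exact step (k + 1) Q ⟨R, hR, fun m hm => hc m hm⟩

lemma induction_on_monic {N : ℕ} {P : ℕ → (Mat N)[X]} (hdeg : ∀ n, (P n).natDegree = n)
    (hmonic : ∀ n, (P n).Monic) {motive : (Mat N)[X] → Prop} (zero : motive 0)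
    (add : ∀ Q Q', motive Q → motive Q' → motive (Q + Q'))
    (C_mul : ∀ k M, motive (C M * P k)) (Q : (Mat N)[X]) : motive Q := by
  obtain ⟨-, h, -⟩ := exists_rel_of_eigen hdeg hmonic 0 (fun Q _ => motive Q) zero
    (fun Q _ Q' _ => add Q Q') (fun k M => C_mul k M) Q.natDegree Q
    (fun m hm => coeff_eq_zero_of_natDegree_lt hm)
  exact h

lemma apply_eq_zero_of_mul_apply_eq_zero {N : ℕ} {A : Mat N}
    (hA : ∀ p q : Fin N, ¬(Even (p : ℕ) ∧ Odd (q : ℕ)) → A p q = 0) {i : Fin N} {r : Fin N → ℂ[X]}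
    (hr : ∀ j, (1 + (X : ℂ[X]) • A.map C : PolyMat N) i j = 0 →
      (r ᵥ* (1 + (X : ℂ[X]) • A.map C : PolyMat N)) j = 0)
    {j : Fin N} (hij : i ≠ j) (h : ¬(Even (i : ℕ) ∧ Odd (j : ℕ))) : r j = 0 := by
  have hT : ∀ l, i ≠ l → ¬(Even (i : ℕ) ∧ Odd (l : ℕ)) →
      r l + X * ∑ p, r p * C (A p l) = 0 := by
    intro l hil hl
    have h1 := hr l (by simp [Matrix.one_apply_ne hil, hA i l hl])
    rw [Matrix.vecMul_add, Matrix.vecMul_one, Matrix.vecMul_smul] at h1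
    simpa [Matrix.vecMul, dotProduct] using h1
  have heven : ∀ l, i ≠ l → Even (l : ℕ) → r l = 0 := by
    intro l hil hl
    have h1 := hT l hil fun h => Nat.not_odd_iff_even.2 hl h.2
    rw [Finset.sum_eq_zero] at h1
    · simpa using h1
    · intro p _
      rw [hA p l fun h => Nat.not_odd_iff_even.2 hl h.2]
      simp
  rcases Nat.even_or_odd (j : ℕ) with hj | hj
  · exact heven j hij hj
  · have hi : ¬Even (i : ℕ) := fun hi => h ⟨hi, hj⟩
    have h1 := hT j hij h
    rw [Finset.sum_eq_zero] at h1
    · simpa using h1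
    · intro p _
      by_cases hp : Even (p : ℕ)
      · rw [heven p (fun e => hi (e ▸ hp)) hp, zero_mul]
      · rw [hA p j fun h => hp h.1]
        simp

/-- The matrices whose off-diagonal entries live only in (even, odd) positions. -/
def IsParityTriangular {N : ℕ} (M : Mat N) : Prop :=
  ∀ i j : Fin N, i ≠ j → ¬(Even (i : ℕ) ∧ Odd (j : ℕ)) → M i j = 0

lemma IsParityTriangular.commutator_apply {N : ℕ} {L M : Mat N} (hL : IsParityTriangular L)
    (hM : IsParityTriangular M) (i j : Fin N) (h : ¬(Even (i : ℕ) ∧ Odd (j : ℕ))) :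
    (L * M - M * L) i j = 0 := by
  have key : ∀ {L M : Mat N}, IsParityTriangular L → IsParityTriangular M →
      (L * M) i j = if i = j then L i i * M i i else 0 := by
    intro L M hL hM
    rw [Matrix.mul_apply, Finset.sum_eq_single i]
    · split_ifs with hij
      · rw [hij]
      · rw [hM i j hij h, mul_zero]
    · intro k _ hk
      by_cases hik : Even (i : ℕ) ∧ Odd (k : ℕ)
      · by_cases hkj : k = j
        · exact absurd (hkj ▸ hik) h
        · rw [hM k j hkj fun h' => Nat.not_even_iff_odd.2 hik.2 h'.1, mul_zero]
      · rw [hL i k hk.symm hik, zero_mul]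
    · simp
  rw [Matrix.sub_apply, key hL hM, key hM hL]
  split_ifs <;> ring

lemma mul_eq_zero_of_parity {N : ℕ} {L M : Mat N}
    (hL : ∀ i j : Fin N, ¬(Even (i : ℕ) ∧ Odd (j : ℕ)) → L i j = 0)
    (hM : ∀ i j : Fin N, ¬(Even (i : ℕ) ∧ Odd (j : ℕ)) → M i j = 0) : L * M = 0 := by
  ext i j
  rw [Matrix.mul_apply]
  refine Finset.sum_eq_zero fun k _ => ?_
  rcases Nat.even_or_odd (k : ℕ) with hk | hk
  · rw [hL i k fun h => Nat.not_odd_iff_even.2 hk h.2, zero_mul]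
  · rw [hM k j fun h => Nat.not_even_iff_odd.2 hk h.1, mul_zero]

/-- The form `∫ P W Q^*` attached to the weight `W = T diag(e^{-x² + 2βᵢx}) T^*`. -/
def weightForm {N : ℕ} (β : Fin N → ℝ) (T : PolyMat N) (P Q : (Mat N)[X]) : Mat N :=
  hermiteForm β (toPolyMat P * T) (toPolyMat Q * T)

section weightForm

variable {N : ℕ} {β : Fin N → ℝ} {T S : PolyMat N}

lemma weightForm_add_left (P P' Q : (Mat N)[X]) :
    weightForm β T (P + P') Q = weightForm β T P Q + weightForm β T P' Q := by
  simp only [weightForm, map_add, add_mul, hermiteForm_add_left]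

lemma weightForm_add_right (P Q Q' : (Mat N)[X]) :
    weightForm β T P (Q + Q') = weightForm β T P Q + weightForm β T P Q' := by
  simp only [weightForm, map_add, add_mul, hermiteForm_add_right]

lemma weightForm_C_mul_left (M : Mat N) (P Q : (Mat N)[X]) :
    weightForm β T (C M * P) Q = M * weightForm β T P Q := by
  simp only [weightForm, toPolyMat_C_mul, mul_assoc, hermiteForm_map_C_mul_left]

lemma weightForm_C_mul_right (M : Mat N) (P Q : (Mat N)[X]) :
    weightForm β T P (C M * Q) = weightForm β T P Q * Mᴴ := by
  simp only [weightForm, toPolyMat_C_mul, mul_assoc, hermiteForm_map_C_mul_right]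

lemma weightForm_zero_left (Q : (Mat N)[X]) : weightForm β T 0 Q = 0 := by
  rw [weightForm, map_zero, zero_mul, hermiteForm_zero_left]

lemma weightForm_zero_right (P : (Mat N)[X]) : weightForm β T P 0 = 0 := by
  rw [weightForm, map_zero, zero_mul, hermiteForm_zero_right]

lemma eq_zero_of_weightForm_self (hTS : T * S = 1) {P : (Mat N)[X]}
    (h : weightForm β T P P = 0) : P = 0 := by
  have h1 := eq_zero_of_hermiteForm_self β _ h
  have h2 : toPolyMat P = 0 := by rw [← mul_one (toPolyMat P), ← hTS, ← mul_assoc, h1, zero_mul]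
  simpa using h2

lemma eq_zero_of_C_mul_monic {M : Mat N} {P : (Mat N)[X]} (hP : P.Monic) (h : C M * P = 0) :
    M = 0 := by
  have h1 := congrArg (fun Q => Q.coeff P.natDegree) h
  simpa [coeff_C_mul, hP.coeff_natDegree] using h1

lemma isUnit_det_weightForm_self (hTS : T * S = 1) {P : (Mat N)[X]} (hP : P.Monic) :
    IsUnit (weightForm β T P P).det := by
  rw [isUnit_iff_ne_zero]
  intro hdet
  obtain ⟨v, hv, hv0⟩ := Matrix.exists_vecMul_eq_zero_iff.2 hdet
  set M : Mat N := Matrix.of fun _ => v with hM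
  have h1 : M * weightForm β T P P = 0 := by
    ext i j
    simpa [Matrix.mul_apply, Matrix.vecMul, dotProduct, hM] using congrFun hv0 j
  have h2 : M = 0 := by
    refine eq_zero_of_C_mul_monic hP (eq_zero_of_weightForm_self (β := β) hTS ?_)
    rw [weightForm_C_mul_left, weightForm_C_mul_right, ← mul_assoc, h1, zero_mul]
  apply hv
  ext t
  exact congrFun (congrFun h2 t) t

/-- The eigenvalue of the adjoint operator. -/
def adjointEigenvalue (β : Fin N → ℝ) (T : PolyMat N) (P : (Mat N)[X]) (L : Mat N) : Mat N :=
  ((weightForm β T P P)⁻¹ * L * weightForm β T P P)ᴴ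

lemma weightForm_mul_adjointEigenvalue (hTS : T * S = 1) {P : (Mat N)[X]} (hP : P.Monic)
    (L : Mat N) : weightForm β T P P * (adjointEigenvalue β T P L)ᴴ =
      L * weightForm β T P P := by
  rw [adjointEigenvalue, Matrix.conjTranspose_conjTranspose, mul_assoc, ← mul_assoc,
    Matrix.mul_nonsing_inv _ (isUnit_det_weightForm_self hTS hP), one_mul]

variable {P : ℕ → (Mat N)[X]} {F : ℕ → (Mat N)[X]} {d : ℕ} {Λ : ℕ → Mat N}

lemma weightForm_opSum_eigen (hTS : T * S = 1) (hdeg : ∀ n, (P n).natDegree = n)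
    (hmonic : ∀ n, (P n).Monic) (horth : ∀ n m, n ≠ m → weightForm β T (P n) (P m) = 0)
    (heig : ∀ k, opSum F d (P k) = C (Λ k) * P k) (k : ℕ) (M : Mat N) (Q : (Mat N)[X]) :
    weightForm β T (opSum F d Q) (C M * P k) =
      weightForm β T Q (C (M * adjointEigenvalue β T (P k) (Λ k)) * P k) := by
  rw [weightForm_C_mul_right, weightForm_C_mul_right, Matrix.conjTranspose_mul, ← mul_assoc]
  congr 1
  induction Q using induction_on_monic hdeg hmonic with
  | zero => rw [opSum_zero, weightForm_zero_left, zero_mul]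
  | add Q Q' hQ hQ' => rw [opSum_add, weightForm_add_left, weightForm_add_left, add_mul, hQ, hQ']
  | C_mul l M' =>
    rw [opSum_C_mul, heig, weightForm_C_mul_left, weightForm_C_mul_left, weightForm_C_mul_left,
      mul_assoc]
    congr 1
    rcases eq_or_ne l k with rfl | hlk
    · rw [weightForm_mul_adjointEigenvalue hTS (hmonic l)]
    · rw [horth l k hlk, mul_zero, zero_mul]

lemma exists_adjoint_opSum (hTS : T * S = 1) (hdeg : ∀ n, (P n).natDegree = n)
    (hmonic : ∀ n, (P n).Monic) (horth : ∀ n m, n ≠ m → weightForm β T (P n) (P m) = 0)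
    (heig : ∀ k, opSum F d (P k) = C (Λ k) * P k) (k : ℕ) (Q : (Mat N)[X])
    (hQ : ∀ m, k < m → Q.coeff m = 0) :
    ∃ R, (∀ U, weightForm β T (opSum F d U) Q = weightForm β T U R) ∧
      (∀ m, k < m → R.coeff m = 0) ∧
        R.coeff k = Q.coeff k * adjointEigenvalue β T (P k) (Λ k) := by
  refine exists_rel_of_eigen hdeg hmonic (fun k => adjointEigenvalue β T (P k) (Λ k))
    (fun Q R => ∀ U, weightForm β T (opSum F d U) Q = weightForm β T U R) ?_ ?_ ?_ k Q hQ
  · intro U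
    rw [weightForm_zero_right, weightForm_zero_right]
  · intro Q R Q' R' h h' U
    rw [weightForm_add_right, weightForm_add_right, h, h']
  · intro k M U
    exact weightForm_opSum_eigen hTS hdeg hmonic horth heig k M U

lemma weightForm_opSum_eq_conjOp (U : PolyMat N) (Q : (Mat N)[X]) :
    weightForm β T (opSum F d (toPolyMat.symm (U * S))) Q =
      hermiteForm β (conjOp T S F d U) (toPolyMat Q * T) := rfl

lemma weightForm_toPolyMat_symm (hST : S * T = 1) (U : PolyMat N) (Q : (Mat N)[X]) :
    weightForm β T (toPolyMat.symm (U * S)) Q = hermiteForm β U (toPolyMat Q * T) := by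
  rw [weightForm, AlgEquiv.apply_symm_apply, mul_assoc, hST, mul_one]

lemma exists_adjoint_conjOp (hTS : T * S = 1) (hST : S * T = 1)
    (hdeg : ∀ n, (P n).natDegree = n)
    (hmonic : ∀ n, (P n).Monic) (horth : ∀ n m, n ≠ m → weightForm β T (P n) (P m) = 0)
    (heig : ∀ k, opSum F d (P k) = C (Λ k) * P k) (V : PolyMat N) :
    ∃ R, ∀ U, hermiteForm β (conjOp T S F d U) V = hermiteForm β U R := by
  obtain ⟨R, hR, -⟩ := exists_adjoint_opSum hTS hdeg hmonic horth heig _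
    (toPolyMat.symm (V * S)) (fun m hm => coeff_eq_zero_of_natDegree_lt hm)
  refine ⟨toPolyMat R * T, fun U => ?_⟩
  have h := hR (toPolyMat.symm (U * S))
  rwa [weightForm_toPolyMat_symm hST, weightForm_opSum_eq_conjOp,
    AlgEquiv.apply_symm_apply, mul_assoc V, hST, mul_one] at h

end weightForm

/-- The matrix polynomial `T(x) = 1 + x A`, as a matrix with polynomial entries. -/
def onePlusX {N : ℕ} (A : Mat N) : PolyMat N := 1 + (X : ℂ[X]) • A.map C

lemma onePlusX_mul_neg {N : ℕ} {A : Mat N} (hA : A * A = 0) : onePlusX A * onePlusX (-A) = 1 := by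
  have h : A.map (C : ℂ → ℂ[X]) * A.map C = 0 := by
    have h1 := congrArg (C : ℂ →+* ℂ[X]).mapMatrix hA
    rwa [map_mul, map_zero] at h1
  have hneg : (-A).map (C : ℂ → ℂ[X]) = -A.map C := by
    ext1 i j
    simp
  rw [onePlusX, onePlusX, hneg, smul_neg, add_mul, one_mul, mul_add, mul_one, mul_neg,
    Matrix.smul_mul, Matrix.mul_smul, h]
  simp

lemma onePlusX_neg_mul {N : ℕ} {A : Mat N} (hA : A * A = 0) : onePlusX (-A) * onePlusX A = 1 := by
  simpa using onePlusX_mul_neg (A := -A) (by simpa using hA)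

lemma isParityTriangular_of_forall_exists {N : ℕ} {A M : Mat N}
    (hA : ∀ p q : Fin N, ¬(Even (p : ℕ) ∧ Odd (q : ℕ)) → A p q = 0) (k : ℕ)
    (h : ∀ Q : (Mat N)[X], (∀ m, k < m → Q.coeff m = 0) →
      ∃ R : (Mat N)[X], (∀ i j, (toPolyMat Q * onePlusX A) i j = 0 →
        (toPolyMat R * onePlusX A) i j = 0) ∧ R.coeff k = Q.coeff k * M) :
    IsParityTriangular M := by
  intro i j hij hpar
  obtain ⟨R, hR, hc⟩ := h (C (Matrix.single i i 1) * X ^ k) fun m hm => by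
    rw [coeff_C_mul_X_pow, if_neg hm.ne']
  have hQ : ∀ l, (toPolyMat (C (Matrix.single i i 1) * X ^ k : (Mat N)[X]) * onePlusX A) i l =
      toPolyMat (X ^ k : (Mat N)[X]) i i * onePlusX A i l := by
    intro l
    rw [toPolyMat_C_mul, Matrix.map_single _ _ _ (C : ℂ →+* ℂ[X]), mul_assoc,
      Matrix.single_mul_apply_same, map_one, one_mul, Matrix.mul_apply, Finset.sum_eq_single i]
    · intro l' _ hl'
      have : toPolyMat (X ^ k : (Mat N)[X]) i l' = 0 := by
        ext1 m
        rw [matPolyEquiv_symm_apply_coeff, coeff_X_pow]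
        split_ifs
        · rw [Matrix.one_apply_ne hl'.symm, coeff_zero]
        · rfl
      rw [this, zero_mul]
    · simp
  have h0 : toPolyMat R i j = 0 :=
    apply_eq_zero_of_mul_apply_eq_zero hA (r := toPolyMat R i)
      (fun l hl => hR i l (by rw [hQ, onePlusX, hl, mul_zero])) hij hpar
  have h1 := matPolyEquiv_symm_apply_coeff R i j k
  rw [hc, coeff_C_mul_X_pow, if_pos rfl, Matrix.single_mul_apply_same, one_mul] at h1
  rw [← h1, show matPolyEquiv.symm R i j = 0 from h0, coeff_zero]

section eigenvalues

variable {N : ℕ} {β : Fin N → ℝ} {A : Mat N} {P : ℕ → (Mat N)[X]}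

lemma isParityTriangular_eigenvalue (hβ : Function.Injective β) (hA2 : A * A = 0)
    (hA : ∀ p q : Fin N, ¬(Even (p : ℕ) ∧ Odd (q : ℕ)) → A p q = 0)
    (hdeg : ∀ n, (P n).natDegree = n) (hmonic : ∀ n, (P n).Monic)
    (horth : ∀ n m, n ≠ m → weightForm β (onePlusX A) (P n) (P m) = 0)
    {F : ℕ → (Mat N)[X]} {d : ℕ} {Λ : ℕ → Mat N}
    (heig : ∀ k, opSum F d (P k) = C (Λ k) * P k) (k : ℕ) :
    IsParityTriangular (Λ k) ∧
      IsParityTriangular (adjointEigenvalue β (onePlusX A) (P k) (Λ k)) := by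
  have hTS := onePlusX_mul_neg hA2
  have hST := onePlusX_neg_mul hA2
  have hadj := exists_adjoint_conjOp hTS hST hdeg hmonic horth heig
  constructor
  · refine isParityTriangular_of_forall_exists hA k fun Q hQ => ?_
    obtain ⟨R, hR, -, hc⟩ := exists_rel_of_eigen hdeg hmonic Λ (fun Q R => opSum F d Q = R)
      (opSum_zero F d) (fun Q R Q' R' h h' => by rw [opSum_add, h, h'])
      (fun k M => by rw [opSum_C_mul, heig, ← mul_assoc, ← C_mul]) k Q hQ
    refine ⟨R, fun i j hij => ?_, hc⟩
    have h := conjOp_apply_of_adjoint (onePlusX A) (onePlusX (-A)) F d hβ hadj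
      (toPolyMat Q * onePlusX A) i j
    rw [hij, map_zero, conjOp, mul_assoc (toPolyMat Q), hTS, mul_one,
      AlgEquiv.symm_apply_apply, hR] at h
    exact h
  · refine isParityTriangular_of_forall_exists hA k fun Q hQ => ?_
    obtain ⟨R, hR, -, hc⟩ := exists_adjoint_opSum hTS hdeg hmonic horth heig k Q hQ
    refine ⟨R, fun i j hij => ?_, hc⟩
    refine adjoint_apply_eq_zero (onePlusX A) (onePlusX (-A)) F d hβ hadj (fun U => ?_) hij
    have h := hR (toPolyMat.symm (U * onePlusX (-A)))
    rwa [weightForm_toPolyMat_symm hST, weightForm_opSum_eq_conjOp] at h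

lemma eigenvalues_commute (hβ : Function.Injective β) (hA2 : A * A = 0)
    (hA : ∀ p q : Fin N, ¬(Even (p : ℕ) ∧ Odd (q : ℕ)) → A p q = 0)
    (hdeg : ∀ n, (P n).natDegree = n) (hmonic : ∀ n, (P n).Monic)
    (horth : ∀ n m, n ≠ m → weightForm β (onePlusX A) (P n) (P m) = 0)
    {F H : ℕ → (Mat N)[X]} {d e : ℕ} {Λ M : ℕ → Mat N}
    (heigF : ∀ k, opSum F d (P k) = C (Λ k) * P k)
    (heigH : ∀ k, opSum H e (P k) = C (M k) * P k) (k : ℕ) : Λ k * M k = M k * Λ k := by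
  obtain ⟨hL, hL'⟩ := isParityTriangular_eigenvalue hβ hA2 hA hdeg hmonic horth heigF k
  obtain ⟨hM, hM'⟩ := isParityTriangular_eigenvalue hβ hA2 hA hdeg hmonic horth heigH k
  have hTS := onePlusX_mul_neg hA2
  have eL := weightForm_mul_adjointEigenvalue (β := β) hTS (hmonic k) (Λ k)
  have eM := weightForm_mul_adjointEigenvalue (β := β) hTS (hmonic k) (M k)
  set L' := adjointEigenvalue β (onePlusX A) (P k) (Λ k)
  set M' := adjointEigenvalue β (onePlusX A) (P k) (M k)
  set G := weightForm β (onePlusX A) (P k) (P k) with hG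
  set K := Λ k * M k - M k * Λ k with hK
  have h0 : K * (M' * L' - L' * M') = 0 :=
    mul_eq_zero_of_parity (hL.commutator_apply hM) (hM'.commutator_apply hL')
  have h1 : K * G = G * (M' * L' - L' * M')ᴴ := by
    rw [hK, Matrix.conjTranspose_sub, Matrix.conjTranspose_mul, Matrix.conjTranspose_mul,
      sub_mul, mul_sub, ← mul_assoc G, ← mul_assoc G, eL, eM, mul_assoc (Λ k) G,
      mul_assoc (M k) G, eL, eM, mul_assoc, mul_assoc]
  have h2 : K = 0 := by
    refine eq_zero_of_C_mul_monic (hmonic k) (eq_zero_of_weightForm_self (β := β) hTS ?_)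
    rw [weightForm_C_mul_left, weightForm_C_mul_right, ← mul_assoc, ← hG, h1, mul_assoc,
      ← Matrix.conjTranspose_mul, h0, Matrix.conjTranspose_zero, mul_zero]
  exact sub_eq_zero.1 h2

lemma opSum_comm (hβ : Function.Injective β) (hA2 : A * A = 0)
    (hA : ∀ p q : Fin N, ¬(Even (p : ℕ) ∧ Odd (q : ℕ)) → A p q = 0)
    (hdeg : ∀ n, (P n).natDegree = n) (hmonic : ∀ n, (P n).Monic)
    (horth : ∀ n m, n ≠ m → weightForm β (onePlusX A) (P n) (P m) = 0)
    {F H : ℕ → (Mat N)[X]} {d e : ℕ} {Λ M : ℕ → Mat N}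
    (heigF : ∀ k, opSum F d (P k) = C (Λ k) * P k)
    (heigH : ∀ k, opSum H e (P k) = C (M k) * P k) (Q : (Mat N)[X]) :
    opSum H e (opSum F d Q) = opSum F d (opSum H e Q) := by
  induction Q using induction_on_monic hdeg hmonic with
  | zero => simp only [opSum_zero]
  | add Q Q' hQ hQ' => simp only [opSum_add, hQ, hQ']
  | C_mul k B =>
    simp only [opSum_C_mul, heigF, heigH]
    rw [← mul_assoc (C (Λ k)), ← C_mul, ← mul_assoc (C (M k)), ← C_mul,
      eigenvalues_commute hβ hA2 hA hdeg hmonic horth heigF heigH k]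

end eigenvalues

lemma EU_apply_eq_zero {N s t : ℕ} (hs : Odd s) (ht : Even t) {p q : Fin N}
    (h : ¬(Even (p : ℕ) ∧ Odd (q : ℕ))) : EU N s t p q = 0 := by
  rw [EU, Matrix.of_apply, if_neg]
  rintro ⟨rfl, rfl⟩
  exact h ⟨by simpa [Nat.odd_add_one] using hs, by simpa [Nat.even_add_one] using ht⟩

lemma Amat_apply_eq_zero (N : ℕ) (a : ℕ → ℝ) (p q : Fin N)
    (h : ¬(Even (p : ℕ) ∧ Odd (q : ℕ))) : Amat N a p q = 0 := by
  rw [Amat, Matrix.add_apply, Matrix.sum_apply, Matrix.sum_apply, Finset.sum_eq_zero,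
    Finset.sum_eq_zero, add_zero]
  · intro j _
    rw [Matrix.smul_apply, EU_apply_eq_zero ⟨j, rfl⟩ (even_two_mul j) h, smul_zero]
  · intro j hj
    have hj1 := (Finset.mem_Icc.1 hj).1
    rw [Matrix.smul_apply, EU_apply_eq_zero ⟨j - 1, by omega⟩ (even_two_mul j) h, smul_zero]

lemma map_eval_toPolyMat {N : ℕ} (P : (Mat N)[X]) (x : ℝ) :
    (toPolyMat P).map (eval (x : ℂ)) = mval P x := by
  rw [matPolyEquiv_symm_map_eval, mval, Matrix.smul_one_eq_diagonal]
  rfl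

lemma map_eval_onePlusX (N : ℕ) (a : ℕ → ℝ) (x : ℝ) :
    (onePlusX (Amat N a)).map (eval (x : ℂ)) = Tmat N a x := by
  ext i j
  simp only [onePlusX, Tmat, Matrix.map_apply, Matrix.add_apply, Matrix.smul_apply, smul_eq_mul,
    eval_add, eval_mul, eval_X, eval_C, Matrix.one_apply]
  split_ifs <;> simp

lemma integral_WH_eq_weightForm (N : ℕ) (a b : ℕ → ℝ) (P Q : (Mat N)[X]) (s t : Fin N) :
    ∫ x : ℝ, (mval P x * WH N a b x * (mval Q x)ᴴ) s t =
      weightForm (fun i : Fin N => b (i + 1)) (onePlusX (Amat N a)) P Q s t := by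
  set U := toPolyMat P * onePlusX (Amat N a) with hU
  set V := toPolyMat Q * onePlusX (Amat N a) with hV
  have heval : ∀ (R : (Mat N)[X]) (x : ℝ), mval R x * Tmat N a x =
      (toPolyMat R * onePlusX (Amat N a)).map (eval (x : ℂ)) := by
    intro R x
    rw [← map_eval_toPolyMat, ← map_eval_onePlusX]
    exact (Matrix.map_mul (f := evalRingHom (x : ℂ))).symm
  have hpt : ∀ x : ℝ, (mval P x * WH N a b x * (mval Q x)ᴴ) s t =
      ∑ i : Fin N, (U s i * conjPoly (V t i)).eval (x : ℂ) *
        (Real.exp (-x ^ 2 + 2 * b (i + 1) * x) : ℂ) := by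
    intro x
    have e : mval P x * WH N a b x * (mval Q x)ᴴ =
        (mval P x * Tmat N a x) * hermiteDiag N b x * (mval Q x * Tmat N a x)ᴴ := by
      rw [WH, Matrix.conjTranspose_mul]
      simp only [mul_assoc]
    rw [e, heval, heval, ← hU, ← hV, Matrix.mul_apply]
    refine Finset.sum_congr rfl fun i _ => ?_
    rw [hermiteDiag, Matrix.mul_diagonal, Matrix.conjTranspose_apply, Matrix.map_apply,
      Matrix.map_apply, eval_mul, eval_conjPoly]
    ring
  simp only [hpt]
  rw [integral_finsetSum _ fun i _ => integrable_eval_mul_gaussian _ _]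
  rfl

/-- the algebra `D(W_H)` is commutative: two differential operators having the
monic orthogonal polynomials of `W_H` as eigenfunctions commute. -/
theorem stmt11 (N : ℕ) (hN : 2 ≤ N) (a : ℕ → ℝ)
    (ha : ∀ j, 1 ≤ j → j ≤ N - 1 → a j ≠ 0)
    (b : ℕ → ℝ)
    (hb : ∀ i j, 1 ≤ i → i ≤ N → 1 ≤ j → j ≤ N → i ≠ j → b i ≠ b j)
    (P : ℕ → Polynomial (Mat N))
    (hdeg : ∀ n, (P n).natDegree = n)
    (hmonic : ∀ n, (P n).Monic)
    (horth : ∀ n m, n ≠ m → ∀ s t : Fin N,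
      ∫ x : ℝ, (mval (P n) x * WH N a b x * (mval (P m) x)ᴴ) s t = 0)
    (n : ℕ) (F : ℕ → Polynomial (Mat N))
    (m : ℕ) (H : ℕ → Polynomial (Mat N))
    (heigF : ∀ k : ℕ, ∃ Λ : Mat N, applyOp F n (P k) = Polynomial.C Λ * P k)
    (heigH : ∀ k : ℕ, ∃ M : Mat N, applyOp H m (P k) = Polynomial.C M * P k) :
    ∀ Q : Polynomial (Mat N),
      applyOp H m (applyOp F n Q) = applyOp F n (applyOp H m Q) := by
  have hA := Amat_apply_eq_zero N a
  have hA2 : Amat N a * Amat N a = 0 := mul_eq_zero_of_parity hA hA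
  have hβ : Function.Injective fun i : Fin N => b ((i : ℕ) + 1) := by
    intro i j hij
    by_contra hne
    exact hb (i + 1) (j + 1) (by omega) (by omega) (by omega) (by omega)
      (fun h => hne (Fin.ext (by omega))) hij
  choose Λ hΛ using heigF
  choose M hM using heigH
  have horth' : ∀ n m, n ≠ m →
      weightForm (fun i : Fin N => b ((i : ℕ) + 1)) (onePlusX (Amat N a)) (P n) (P m) = 0 := by
    intro n m hnm
    ext s t
    rw [← integral_WH_eq_weightForm]
    exact horth n m hnm s t
  exact opSum_comm hβ hA2 hA hdeg hmonic horth' hΛ hM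
end
end

section
/- Let W̃(x) = diag(e^{−x²+2b_1x}, …, e^{−x²+2b_Nx}) with b_1, …, b_N pairwise distinct real numbers. Suppose F_0, …, F_n ∈ Mat_N(ℂ[x]) and G_0, …, G_m ∈ Mat_N(ℂ[x]) are matrix polynomials such that for all P, Q ∈ Mat_N(ℂ[x]): ∫_ℝ (Σ_{j=0}^{n} P^{(j)}(x) F_j(x)) W̃(x) Q(x)^* dx = ∫_ℝ P(x) W̃(x) (Σ_{k=0}^{m} Q^{(k)}(x) G_k(x))^* dx. Then every coefficient F_j is a diagonal matrix polynomial. (Every operator in the right Fourier algebra of a diagonal Hermite weight with pairwise non-rational ratios has diagonal coefficients.) -/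
open Polynomial MeasureTheory Matrix

noncomputable section

/-- The Hermite weight `e^{-x²+2bx}`, as a complex number. -/
def gaussWeight (b x : ℝ) : ℂ := (Real.exp (-x ^ 2 + 2 * b * x) : ℂ)

lemma integrable_eval_mul_gaussWeight (b : ℝ) (p : ℂ[X]) :
    Integrable fun x : ℝ => p.eval (x : ℂ) * gaussWeight b x := by
  have centered : ∀ q : ℂ[X], Integrable fun x : ℝ =>
      q.eval (x : ℂ) * (Real.exp (-1 * x ^ 2) : ℂ) := by
    intro q
    induction q using Polynomial.induction_on' with
    | add p q hp hq =>
      simp only [eval_add, add_mul]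
      exact hp.add hq
    | monomial n a =>
      have h := integrable_rpow_mul_exp_neg_mul_sq (b := 1) one_pos (s := n)
        (by have : (0 : ℝ) ≤ n := n.cast_nonneg
            linarith)
      refine (h.ofReal.const_mul a).congr (.of_forall fun x => ?_)
      simp [mul_assoc]
  refine (((centered (p.comp (X + C (b : ℂ)))).comp_sub_right b).const_mul
    (Real.exp (b ^ 2) : ℂ)).congr (.of_forall fun x => ?_)
  have hexp : Real.exp (-x ^ 2 + 2 * b * x)
      = Real.exp (b ^ 2) * Real.exp (-1 * (x - b) ^ 2) := by
    rw [← Real.exp_add]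
    congr 1
    ring
  simp only [gaussWeight, hexp, eval_comp, eval_add, eval_X, eval_C]
  push_cast
  ring_nf

/-- Integration of a complex polynomial against the Hermite weight `e^{-x²+2bx}`. -/
def gaussInt (b : ℝ) : ℂ[X] →ₗ[ℂ] ℂ where
  toFun p := ∫ x : ℝ, p.eval (x : ℂ) * gaussWeight b x
  map_add' p q := by
    simp only [eval_add, add_mul]
    exact integral_add (integrable_eval_mul_gaussWeight b p) (integrable_eval_mul_gaussWeight b q)
  map_smul' a p := by
    simp only [eval_smul, smul_eq_mul, mul_assoc, integral_const_mul, RingHom.id_apply]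

lemma gaussInt_apply (b : ℝ) (p : ℂ[X]) :
    gaussInt b p = ∫ x : ℝ, p.eval (x : ℂ) * gaussWeight b x := rfl

/-- The derivative of `q e^{-x²+2bx}` divided by `e^{-x²+2bx}`, as an operator on polynomials. -/
def gaussDeriv (b : ℝ) : Module.End ℂ ℂ[X] :=
  derivative + LinearMap.mulLeft ℂ (C (2 * b : ℂ) - C 2 * X)

lemma gaussDeriv_apply (b : ℝ) (q : ℂ[X]) :
    gaussDeriv b q = derivative q + (C (2 * b : ℂ) - C 2 * X) * q := rfl

lemma gaussInt_gaussDeriv (b : ℝ) (q : ℂ[X]) : gaussInt b (gaussDeriv b q) = 0 := by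
  refine integral_eq_zero_of_hasDerivAt_of_integrable (fun x => ?_)
    (integrable_eval_mul_gaussWeight b _) (integrable_eval_mul_gaussWeight b q)
  have hq : HasDerivAt (fun y : ℝ => q.eval (y : ℂ)) ((derivative q).eval (x : ℂ)) x :=
    (q.hasDerivAt (x : ℂ)).comp_ofReal
  have hw : HasDerivAt (gaussWeight b) ((2 * b - 2 * x) * gaussWeight b x) x := by
    have h : HasDerivAt (fun y : ℝ => -y ^ 2 + 2 * b * y) (2 * b - 2 * x) x := by
      refine (((hasDerivAt_id x).pow 2).neg.add ((hasDerivAt_id x).const_mul (2 * b))).congr_deriv ?_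
      simp
      ring
    refine h.exp.ofReal_comp.congr_deriv ?_
    simp only [gaussWeight]
    push_cast
    ring
  refine (hq.mul hw).congr_deriv ?_
  simp only [gaussDeriv_apply, eval_add, eval_mul, eval_sub, eval_C, eval_X]
  ring

lemma gaussInt_mul_gaussDeriv (b : ℝ) (r q : ℂ[X]) :
    gaussInt b (r * gaussDeriv b q) = -gaussInt b (derivative r * q) := by
  rw [eq_neg_iff_add_eq_zero, ← map_add, ← gaussInt_gaussDeriv b (r * q)]
  congr 1
  simp only [gaussDeriv_apply, derivative_mul]
  ring

lemma gaussInt_mul_derivative (b : ℝ) (r q : ℂ[X]) :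
    gaussInt b (r * derivative q) = -gaussInt b (gaussDeriv b r * q) := by
  rw [eq_neg_iff_add_eq_zero, ← map_add, ← gaussInt_gaussDeriv b (r * q)]
  congr 1
  simp only [gaussDeriv_apply, derivative_mul]
  ring

lemma gaussInt_mul_gaussDeriv_pow (b : ℝ) (d : ℕ) (r q : ℂ[X]) :
    gaussInt b (r * (gaussDeriv b ^ d) q) = (-1) ^ d * gaussInt b (derivative^[d] r * q) := by
  induction d generalizing r with
  | zero => simp
  | succ d ih =>
    rw [pow_succ', Module.End.mul_apply, gaussInt_mul_gaussDeriv, ih, Function.iterate_succ_apply]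
    ring

lemma exists_gaussInt_mul_iterate_derivative (b : ℝ) (k : ℕ) (r : ℂ[X]) :
    ∃ r' : ℂ[X], ∀ q, gaussInt b (r * derivative^[k] q) = gaussInt b (r' * q) := by
  induction k generalizing r with
  | zero => exact ⟨r, fun _ => rfl⟩
  | succ k ih =>
    obtain ⟨r', hr'⟩ := ih (-gaussDeriv b r)
    refine ⟨r', fun q => ?_⟩
    rw [Function.iterate_succ_apply', gaussInt_mul_derivative, ← hr', neg_mul, map_neg]

lemma exists_gaussInt_mul_sum (b : ℝ) (m : ℕ) (p : ℂ[X]) (g : ℕ → ℂ[X]) :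
    ∃ r : ℂ[X], ∀ q, gaussInt b (p * ∑ k ∈ Finset.range m, derivative^[k] q * g k)
      = gaussInt b (r * q) := by
  choose r hr using fun k => exists_gaussInt_mul_iterate_derivative b k (p * g k)
  refine ⟨∑ k ∈ Finset.range m, r k, fun q => ?_⟩
  rw [Finset.mul_sum, Finset.sum_mul, map_sum, map_sum]
  refine Finset.sum_congr rfl fun k _ => ?_
  rw [← hr]
  congr 1
  ring

lemma gaussInt_C_ne_zero (b : ℝ) {c : ℂ} (hc : c ≠ 0) : gaussInt b (C c) ≠ 0 := by
  have hpos : 0 < ∫ x : ℝ, Real.exp (-x ^ 2 + 2 * b * x) := by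
    refine integral_exp_pos ?_
    have h := (integrable_eval_mul_gaussWeight b 1).re
    simpa [gaussWeight, ← Complex.ofReal_exp, -Complex.ofReal_exp] using h
  simp only [gaussInt_apply, gaussWeight, eval_C, integral_const_mul, integral_complex_ofReal]
  exact mul_ne_zero hc (by exact_mod_cast hpos.ne')

lemma eq_zero_of_gaussInt_mul_eq_zero (b : ℝ) (r : ℂ[X])
    (h : ∀ q, gaussInt b (r * q) = 0) : r = 0 := by
  by_contra hr
  have h1 := gaussInt_mul_gaussDeriv_pow b r.natDegree r 1
  have h2 : derivative^[r.natDegree] r = C (r.natDegree.factorial * r.leadingCoeff) := by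
    rw [eq_C_of_natDegree_le_zero
      ((natDegree_iterate_derivative r r.natDegree).trans_eq (Nat.sub_self _))]
    simp [coeff_iterate_derivative, Nat.descFactorial_self]
  rw [h, mul_one, h2] at h1
  refine gaussInt_C_ne_zero b (mul_ne_zero ?_ (leadingCoeff_ne_zero.mpr hr))
    ((mul_eq_zero.mp h1.symm).resolve_left (by simp))
  exact_mod_cast r.natDegree.factorial_ne_zero

/-- Two polynomial multiples of Hermite weights with different parameters have the same moments
only if they vanish. -/
lemma eq_zero_of_gaussInt_mul_eq {a c : ℝ} (hac : a ≠ c) (r s : ℂ[X])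
    (h : ∀ q, gaussInt c (r * q) = gaussInt a (s * q)) : r = 0 := by
  refine eq_zero_of_gaussInt_mul_eq_zero c r fun q => ?_
  have hshift : gaussDeriv c = aeval (gaussDeriv a) (X + C (2 * (c - a) : ℂ)) := by
    refine LinearMap.ext fun q => ?_
    simp only [map_add, aeval_X, aeval_C, LinearMap.add_apply, gaussDeriv_apply,
      Module.algebraMap_end_apply, smul_eq_C_mul]
    simp only [map_sub, map_mul]
    ring
  have hcop : IsCoprime ((X : ℂ[X]) ^ (s.natDegree + 1))
      ((X + C (2 * (c - a) : ℂ)) ^ (r.natDegree + 1)) := by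
    have h0 : C (2 * (c - a) : ℂ) ≠ 0 := by
      simpa [sub_eq_zero] using hac.symm
    refine IsCoprime.pow ⟨-C (2 * (c - a) : ℂ)⁻¹, C (2 * (c - a) : ℂ)⁻¹, ?_⟩
    rw [C_ne_zero] at h0
    have h1 : C (2 * (c - a) : ℂ)⁻¹ * C (2 * (c - a) : ℂ) = 1 := by
      rw [← C_mul, inv_mul_cancel₀ h0, C_1]
    linear_combination h1
  obtain ⟨u, v, huv⟩ := hcop
  have hend := congrArg (aeval (gaussDeriv a)) huv
  rw [mul_comm u, mul_comm v, map_add, map_one, map_mul, map_mul, map_pow, map_pow, aeval_X,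
    ← hshift] at hend
  have hq := LinearMap.congr_fun hend q
  simp only [LinearMap.add_apply, Module.End.mul_apply, Module.End.one_apply] at hq
  have hnil : ∀ (b : ℝ) (r q : ℂ[X]),
      gaussInt b (r * (gaussDeriv b ^ (r.natDegree + 1)) q) = 0 := fun b r q => by
    rw [gaussInt_mul_gaussDeriv_pow, iterate_derivative_eq_zero (Nat.lt_succ_self _), zero_mul,
      map_zero, mul_zero]
  rw [← hq, mul_add, map_add, h, hnil, hnil, add_zero]

lemma eq_zero_of_sum_iterate_derivative_mul_eq_zero (n : ℕ) (f : ℕ → ℂ[X])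
    (h : ∀ p : ℂ[X], ∑ j ∈ Finset.range (n + 1), derivative^[j] p * f j = 0) :
    ∀ j ≤ n, f j = 0 := by
  intro j
  induction j using Nat.strong_induction_on with
  | _ j ih =>
    intro hj
    have hs := h (X ^ j)
    rw [Finset.sum_eq_single_of_mem j (by simp; omega)] at hs
    · rw [iterate_derivative_X_pow_eq_natCast_mul] at hs
      simpa [Nat.descFactorial_self, Nat.factorial_ne_zero] using hs
    · intro i hi hij
      rcases lt_or_gt_of_ne hij with hlt | hgt
      · rw [ih i hlt (by omega), mul_zero]
      · rw [iterate_derivative_eq_zero (by simpa using hgt), zero_mul]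

lemma matPolyEquiv_map_derivative {N : ℕ} (M : Matrix (Fin N) (Fin N) ℂ[X]) :
    derivative (matPolyEquiv M) = matPolyEquiv (M.map derivative) := by
  ext k i j
  rw [matPolyEquiv_coeff_apply, Matrix.map_apply, coeff_derivative, coeff_derivative,
    ← matPolyEquiv_coeff_apply, ← Nat.cast_succ, ← Nat.cast_succ, ← nsmul_eq_mul', ← nsmul_eq_mul',
    Matrix.smul_apply]

lemma applyOp_matPolyEquiv {N : ℕ} (F : ℕ → Polynomial (Mat N)) (n : ℕ)
    (M : Matrix (Fin N) (Fin N) ℂ[X]) :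
    applyOp F n (matPolyEquiv M)
      = matPolyEquiv (∑ j ∈ Finset.range (n + 1),
          M.map derivative^[j] * matPolyEquiv.symm (F j)) := by
  have hiter : ∀ j, (fun Q : Polynomial (Mat N) => derivative Q)^[j] (matPolyEquiv M)
      = matPolyEquiv (M.map derivative^[j]) := by
    intro j
    induction j with
    | zero => simp
    | succ j ih =>
      rw [Function.iterate_succ_apply', ih, matPolyEquiv_map_derivative, Matrix.map_map,
        Function.iterate_succ']
  simp [applyOp, hiter]

lemma mval_matPolyEquiv {N : ℕ} (M : Matrix (Fin N) (Fin N) ℂ[X]) (x : ℝ) (i j : Fin N) :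
    mval (matPolyEquiv M) x i j = (M i j).eval (x : ℂ) := by
  rw [← matPolyEquiv_eval]
  simp [mval, Matrix.smul_one_eq_diagonal]

lemma mul_hermiteDiag_mul_conjTranspose_apply {N : ℕ} (b : ℕ → ℝ) (x : ℝ)
    (A B : Matrix (Fin N) (Fin N) ℂ) (s t : Fin N) :
    (A * hermiteDiag N b x * Bᴴ) s t
      = ∑ i, A s i * gaussWeight (b ((i : ℕ) + 1)) x * star (B t i) := by
  rw [Matrix.mul_apply]
  simp only [hermiteDiag, Matrix.mul_diagonal, gaussWeight, Matrix.conjTranspose_apply]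

lemma star_eval_ofReal (q : ℂ[X]) (x : ℝ) :
    star (q.eval (x : ℂ)) = (q.map (starRingEnd ℂ)).eval (x : ℂ) := by
  have h := Polynomial.eval_map_apply (f := starRingEnd ℂ) (p := q) (x : ℂ)
  simpa using h.symm

/-- The entry `(a, c)` of the adjointness relation, written for scalar polynomials. -/
lemma gaussInt_adjoint_entry {N : ℕ} (b : ℕ → ℝ) (n m : ℕ) (F G : ℕ → Polynomial (Mat N))
    (hadj : ∀ P Q : Polynomial (Mat N), ∀ s t : Fin N,
      ∫ x : ℝ, (mval (applyOp F n P) x * hermiteDiag N b x * (mval Q x)ᴴ) s t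
        = ∫ x : ℝ, (mval P x * hermiteDiag N b x * (mval (applyOp G m Q) x)ᴴ) s t)
    (a c : Fin N) (p q : ℂ[X]) :
    gaussInt (b ((c : ℕ) + 1))
        ((∑ j ∈ Finset.range (n + 1), derivative^[j] p * matPolyEquiv.symm (F j) a c) * q)
      = gaussInt (b ((a : ℕ) + 1)) (p * ∑ k ∈ Finset.range (m + 1),
          derivative^[k] q * (matPolyEquiv.symm (G k) c a).map (starRingEnd ℂ)) := by
  have h := hadj (matPolyEquiv (Matrix.single a a p))
    (matPolyEquiv (Matrix.single c c (q.map (starRingEnd ℂ)))) a c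
  have hstar : (starRingEnd ℂ).comp (starRingEnd ℂ) = RingHom.id ℂ :=
    RingHom.ext Complex.conj_conj
  have hmap : ∀ (p : ℂ[X]) (a : Fin N) (j : ℕ), (Matrix.single a a p).map derivative^[j]
      = Matrix.single a a (derivative^[j] p) := by
    intro p a j
    ext1 i l
    rw [Matrix.map_apply, Matrix.single_apply, Matrix.single_apply]
    split_ifs
    · rfl
    · exact iterate_derivative_zero
  simp only [mul_hermiteDiag_mul_conjTranspose_apply, applyOp_matPolyEquiv, mval_matPolyEquiv,
    star_eval_ofReal, hmap, Matrix.sum_apply] at h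
  simp only [gaussInt_apply]
  convert h using 3 with x x
  · rw [Finset.sum_eq_single c]
    · simp only [Matrix.single_mul_apply_same, Matrix.single_apply_same, Polynomial.map_map, hstar,
        Polynomial.map_id, eval_mul]
      ring
    · intro i _ hi
      simp [Matrix.single_apply_of_col_ne _ _ hi.symm]
    · simp
  · rw [Finset.sum_eq_single a]
    · simp only [Matrix.single_mul_apply_same, Matrix.single_apply_same, Polynomial.map_sum,
        Polynomial.map_mul, ← iterate_derivative_map, Polynomial.map_map, hstar, Polynomial.map_id]
      simp only [eval_mul]
      ring
    · intro i _ hi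
      simp [Matrix.single_apply_of_col_ne _ _ hi.symm]
    · simp

/-- every operator in the right Fourier algebra of a diagonal Hermite weight
with pairwise distinct parameters (so pairwise non-rational ratios of entries) has diagonal
coefficients. -/
theorem stmt13 (N : ℕ) (hN : 2 ≤ N)
    (b : ℕ → ℝ)
    (hb : ∀ i j, 1 ≤ i → i ≤ N → 1 ≤ j → j ≤ N → i ≠ j → b i ≠ b j)
    (n m : ℕ) (F G : ℕ → Polynomial (Mat N))
    (hadj : ∀ P Q : Polynomial (Mat N), ∀ s t : Fin N,
      ∫ x : ℝ, (mval (applyOp F n P) x * hermiteDiag N b x * (mval Q x)ᴴ) s t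
        = ∫ x : ℝ, (mval P x * hermiteDiag N b x * (mval (applyOp G m Q) x)ᴴ) s t) :
    ∀ j, j ≤ n → ∀ k, ((F j).coeff k).IsDiag := by
  intro j hj k a c hac
  obtain ⟨g, hg⟩ : ∃ g : ℕ → ℂ[X], ∀ p q : ℂ[X], gaussInt (b ((c : ℕ) + 1))
        ((∑ j ∈ Finset.range (n + 1), derivative^[j] p * matPolyEquiv.symm (F j) a c) * q)
      = gaussInt (b ((a : ℕ) + 1)) (p * ∑ k ∈ Finset.range (m + 1), derivative^[k] q * g k) :=
    ⟨_, gaussInt_adjoint_entry b n m F G hadj a c⟩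
  have hne : b ((a : ℕ) + 1) ≠ b ((c : ℕ) + 1) :=
    hb _ _ (by omega) (by omega) (by omega) (by omega) (by omega)
  have hF : matPolyEquiv.symm (F j) a c = 0 := by
    refine eq_zero_of_sum_iterate_derivative_mul_eq_zero n
      (fun j => matPolyEquiv.symm (F j) a c) (fun p => ?_) j hj
    obtain ⟨s, hs⟩ := exists_gaussInt_mul_sum (b ((a : ℕ) + 1)) (m + 1) p g
    exact eq_zero_of_gaussInt_mul_eq hne _ s fun q => (hg p q).trans (hs q)
  have hcoeff := matPolyEquiv_coeff_apply (matPolyEquiv.symm (F j)) k a c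
  rw [AlgEquiv.apply_symm_apply] at hcoeff
  rw [hcoeff, hF, coeff_zero]
end
end

section
/- Let b ∈ ℝ and let δ : ℂ[X] → ℂ[X] be the linear map δ(p) = p'' − 2(X−b)p'. For every m ≥ 1 there exist polynomials f_0, …, f_{2m} ∈ ℂ[X] such that the m-fold composition δ^m satisfies δ^m(p) = Σ_{j=0}^{2m} f_j · p^{(j)} for all p ∈ ℂ[X], and these coefficients satisfy: f_{2m} = 1; deg f_j < j for every j with m+1 ≤ j ≤ 2m; and deg(f_m − (−2)^m X^m) < m (i.e., f_m = (−2)^m X^m plus lower-order terms). -/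
open Polynomial

noncomputable section

/-- The scalar Hermite operator `δ(p) = p'' − 2(X−b)p'` for the weight `e^{−x²+2bx}`. -/
def hermiteOp (b : ℝ) (p : Polynomial ℂ) : Polynomial ℂ :=
  derivative (derivative p) - 2 * (X - C (b : ℂ)) * derivative p

/-- Multiplication of the coefficient sequence of a differential operator by `D` on the right. -/
def shiftCoeffs (g : ℕ → ℂ[X]) : ℕ → ℂ[X]
  | 0 => 0
  | j + 1 => g j

/-- The coefficient sequence of `δ ^ m`, from the expansion
`δ(f D^j) = δ(f) D^j + (2 f' - 2 (X - b) f) D^(j+1) + f D^(j+2)`. -/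
def hermiteCoeffs (b : ℝ) : ℕ → ℕ → ℂ[X]
  | 0 => fun j => if j = 0 then 1 else 0
  | m + 1 => fun j =>
      hermiteOp b (hermiteCoeffs b m j) +
        shiftCoeffs (fun i =>
          2 * derivative (hermiteCoeffs b m i) - 2 * (X - C (b : ℂ)) * hermiteCoeffs b m i +
            shiftCoeffs (hermiteCoeffs b m) i) j

theorem shiftCoeffs_succ (g : ℕ → ℂ[X]) (j : ℕ) : shiftCoeffs g (j + 1) = g j := rfl

theorem sum_shiftCoeffs (g d : ℕ → ℂ[X]) (n : ℕ) :
    ∑ j ∈ Finset.range (n + 1), shiftCoeffs g j * d j =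
      ∑ j ∈ Finset.range n, g j * d (j + 1) := by
  rw [Finset.sum_range_succ']
  simp [shiftCoeffs]

theorem hermiteOp_zero (b : ℝ) : hermiteOp b 0 = 0 := by
  simp [hermiteOp]

theorem hermiteOp_sum (b : ℝ) (s : Finset ℕ) (g : ℕ → ℂ[X]) :
    hermiteOp b (∑ j ∈ s, g j) = ∑ j ∈ s, hermiteOp b (g j) := by
  simp [hermiteOp, Finset.mul_sum, Finset.sum_sub_distrib]

theorem hermiteOp_mul (b : ℝ) (f q : ℂ[X]) :
    hermiteOp b (f * q) = hermiteOp b f * q +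
      (2 * derivative f - 2 * (X - C (b : ℂ)) * f) * derivative q +
        f * derivative (derivative q) := by
  simp only [hermiteOp, derivative_mul, derivative_add]
  ring

theorem coeff_two_mul_X_sub_C_mul_succ (b : ℝ) (q : ℂ[X]) (k : ℕ) :
    (2 * (X - C (b : ℂ)) * q).coeff (k + 1) = 2 * q.coeff k - 2 * b * q.coeff (k + 1) := by
  rw [show 2 * (X - C (b : ℂ)) * q = C 2 * (X * q) - C 2 * (C (b : ℂ) * q) by
    simp only [map_ofNat]; ring]
  simp [coeff_C_mul, mul_assoc]

theorem coeff_hermiteOp_eq_zero (b : ℝ) {q : ℂ[X]} {n : ℕ} (hq : ∀ k, n ≤ k → q.coeff k = 0)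
    {k : ℕ} (hk : n ≤ k) : (hermiteOp b q).coeff k = 0 := by
  cases k with
  | zero =>
    simp [hermiteOp, coeff_derivative, hq 1 (by lia),
      hq 2 (by lia)]
  | succ k =>
    simp [hermiteOp, coeff_two_mul_X_sub_C_mul_succ, coeff_derivative, hq (k + 1) hk,
      hq (k + 1 + 1) (by lia), hq (k + 1 + 1 + 1) (by lia)]

theorem coeff_two_mul_derivative (q : ℂ[X]) (k : ℕ) :
    (2 * derivative q).coeff k = 2 * (q.coeff (k + 1) * (k + 1)) := by
  rw [show (2 : ℂ[X]) = C 2 from rfl, coeff_C_mul, coeff_derivative]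

theorem coeff_hermiteCoeffs_eq_zero (b : ℝ) (m : ℕ) :
    ∀ j k, 2 * m < j + k ∨ j < k → (hermiteCoeffs b m j).coeff k = 0 := by
  induction m with
  | zero =>
    intro j k h
    by_cases hj : j = 0
    · have hk : k ≠ 0 := by lia
      simp [hermiteCoeffs, hj, coeff_one, hk]
    · simp [hermiteCoeffs, hj]
  | succ m ih =>
    intro j k h
    have h₀ : (hermiteOp b (hermiteCoeffs b m j)).coeff k = 0 :=
      coeff_hermiteOp_eq_zero b (n := k) (fun l hl => ih j l (by lia)) le_rfl
    rcases j with _ | j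
    · simp [hermiteCoeffs, shiftCoeffs, h₀]
    · have h₁ : (shiftCoeffs (hermiteCoeffs b m) j).coeff k = 0 := by
        rcases j with _ | j
        · simp [shiftCoeffs]
        · exact ih j k (by lia)
      have h₂ : (2 * (X - C (b : ℂ)) * hermiteCoeffs b m j).coeff k = 0 := by
        rcases k with _ | k
        · simp [ih j 0 (by lia)]
        · simp [coeff_two_mul_X_sub_C_mul_succ, ih j k (by lia), ih j (k + 1) (by lia)]
      simp only [hermiteCoeffs, shiftCoeffs_succ, coeff_add, coeff_sub, h₀, h₁, h₂,
        coeff_two_mul_derivative, ih j (k + 1) (by lia)]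
      ring

theorem hermiteCoeffs_eq_zero (b : ℝ) {m j : ℕ} (h : 2 * m < j) : hermiteCoeffs b m j = 0 := by
  ext k
  simpa using coeff_hermiteCoeffs_eq_zero b m j k (by lia)

theorem hermiteCoeffs_two_mul (b : ℝ) (m : ℕ) : hermiteCoeffs b m (2 * m) = 1 := by
  induction m with
  | zero => simp [hermiteCoeffs]
  | succ m ih =>
    rw [show 2 * (m + 1) = 2 * m + 1 + 1 by ring]
    simp [hermiteCoeffs, shiftCoeffs, ih, hermiteCoeffs_eq_zero b (m := m) (j := 2 * m + 1),
      hermiteCoeffs_eq_zero b (m := m) (j := 2 * m + 1 + 1), hermiteOp_zero]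

theorem coeff_hermiteCoeffs_self (b : ℝ) (m : ℕ) :
    (hermiteCoeffs b m m).coeff m = (-2) ^ m := by
  induction m with
  | zero => simp [hermiteCoeffs]
  | succ m ih =>
    have h₀ : (hermiteOp b (hermiteCoeffs b m (m + 1))).coeff (m + 1) = 0 :=
      coeff_hermiteOp_eq_zero b (n := m + 1)
        (fun l hl => coeff_hermiteCoeffs_eq_zero b m _ l (by lia)) le_rfl
    have h₁ : (shiftCoeffs (hermiteCoeffs b m) m).coeff (m + 1) = 0 := by
      cases m with
      | zero => simp [shiftCoeffs]
      | succ n => exact coeff_hermiteCoeffs_eq_zero b _ _ _ (by lia)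
    simp only [hermiteCoeffs, shiftCoeffs_succ, coeff_add, coeff_sub, h₀, h₁, ih,
      coeff_two_mul_derivative, coeff_two_mul_X_sub_C_mul_succ,
      coeff_hermiteCoeffs_eq_zero b m m (m + 1) (by lia),
      coeff_hermiteCoeffs_eq_zero b m m (m + 1 + 1) (by lia)]
    ring

theorem hermiteOp_iterate_eq_sum (b : ℝ) (m : ℕ) (p : ℂ[X]) :
    (hermiteOp b)^[m] p =
      ∑ j ∈ Finset.range (2 * m + 1),
        hermiteCoeffs b m j * (fun q : ℂ[X] => derivative q)^[j] p := by
  induction m with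
  | zero => simp [hermiteCoeffs]
  | succ m ih =>
    rw [Function.iterate_succ_apply', ih, hermiteOp_sum,
      show 2 * (m + 1) + 1 = 2 * m + 1 + 1 + 1 by ring]
    simp only [hermiteCoeffs, hermiteOp_mul, add_mul, Finset.sum_add_distrib, sum_shiftCoeffs,
      ← Function.iterate_succ_apply' (fun q : ℂ[X] => derivative q)]
    simp [Finset.sum_range_succ _ (2 * m + 1), Finset.sum_range_succ _ (2 * m + 1 + 1),
      hermiteCoeffs_eq_zero b (m := m) (j := 2 * m + 1),
      hermiteCoeffs_eq_zero b (m := m) (j := 2 * m + 1 + 1), hermiteOp_zero, add_assoc]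

/-- the `m`-fold power of the Hermite operator `δ` has coefficients
`f_0, …, f_{2m}` with `f_{2m} = 1`, `deg f_j < j` for `m+1 ≤ j ≤ 2m`, and
`f_m = (−2)ᵐ Xᵐ` plus lower-order terms. -/
theorem stmt15 (b : ℝ) (m : ℕ) (hm : 1 ≤ m) :
    ∃ f : ℕ → Polynomial ℂ,
      (∀ p : Polynomial ℂ,
        (hermiteOp b)^[m] p
          = ∑ j ∈ Finset.range (2 * m + 1),
              f j * (fun q : Polynomial ℂ => derivative q)^[j] p) ∧
      f (2 * m) = 1 ∧
      (∀ j, m + 1 ≤ j → j ≤ 2 * m → (f j).degree < (j : WithBot ℕ)) ∧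
      (f m - C ((-2 : ℂ)) ^ m * X ^ m).degree < (m : WithBot ℕ) := by
  refine ⟨hermiteCoeffs b m, hermiteOp_iterate_eq_sum b m, hermiteCoeffs_two_mul b m, ?_, ?_⟩
  · intro j hj _
    rw [degree_lt_iff_coeff_zero]
    intro k hk
    exact coeff_hermiteCoeffs_eq_zero b m j k (by lia)
  · rw [degree_lt_iff_coeff_zero]
    intro k hk
    rw [← C_pow, coeff_sub, coeff_C_mul, coeff_X_pow]
    rcases hk.eq_or_lt with rfl | hk
    · simp [coeff_hermiteCoeffs_self]
    · simp [hk.ne', coeff_hermiteCoeffs_eq_zero b m m k (by lia)]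
end
end

section
/- Let α ∈ ℝ and let δ : ℂ[X] → ℂ[X] be the linear map δ(p) = X·p'' + (α+1−X)·p'. For every m ≥ 1 there exist polynomials f_0, …, f_{2m} ∈ ℂ[X] such that the m-fold composition δ^m satisfies δ^m(p) = Σ_{j=0}^{2m} f_j · p^{(j)} for all p ∈ ℂ[X], and these coefficients satisfy: f_{2m} = X^m; deg f_j < j for every j with m+1 ≤ j ≤ 2m; and deg(f_m − (−1)^m X^m) < m (i.e., f_m = (−1)^m X^m plus lower-order terms). -/
open Polynomial

noncomputable section

/-- The scalar Laguerre operator `δ(p) = X·p'' + (α+1−X)·p'` for the weight `e^{−x}x^α`. -/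
def laguerreOp (α : ℝ) (p : Polynomial ℂ) : Polynomial ℂ :=
  X * derivative (derivative p) + (C ((α : ℂ) + 1) - X) * derivative p

/-- The sequence `0, a 0, a 1, …`. -/
def shiftSeq (a : ℕ → Polynomial ℂ) : ℕ → Polynomial ℂ
  | 0 => 0
  | j + 1 => a j

/-- The coefficients of `δ ∘ L`, where `L` is the differential operator with coefficients `f`. -/
def laguerreCoeffs (α : ℝ) (f : ℕ → Polynomial ℂ) (j : ℕ) : Polynomial ℂ :=
  laguerreOp α (f j)
    + shiftSeq (fun i => 2 * (X * derivative (f i)) + (C ((α : ℂ) + 1) - X) * f i) j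
    + shiftSeq (shiftSeq fun i => X * f i) j

theorem laguerreOp_sum (α : ℝ) (s : Finset ℕ) (g : ℕ → Polynomial ℂ) :
    laguerreOp α (∑ j ∈ s, g j) = ∑ j ∈ s, laguerreOp α (g j) := by
  simp only [laguerreOp, derivative_sum, Finset.mul_sum, Finset.sum_add_distrib]

theorem laguerreOp_mul (α : ℝ) (f q : Polynomial ℂ) :
    laguerreOp α (f * q) = laguerreOp α f * q
      + (2 * (X * derivative f) + (C ((α : ℂ) + 1) - X) * f) * derivative q
      + X * f * derivative (derivative q) := by
  simp only [laguerreOp, derivative_mul, derivative_add]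
  ring

theorem laguerreOp_sum_mul (α : ℝ) (f D : ℕ → Polynomial ℂ) (N : ℕ)
    (hD : ∀ j, derivative (D j) = D (j + 1)) (hf : ∀ j, N ≤ j → f j = 0) :
    laguerreOp α (∑ j ∈ Finset.range N, f j * D j)
      = ∑ j ∈ Finset.range (N + 2), laguerreCoeffs α f j * D j := by
  simp only [laguerreOp_sum, laguerreOp_mul, laguerreCoeffs, add_mul _ _ (D _), hD,
    Finset.sum_add_distrib]
  congr 1
  · congr 1
    · simp [Finset.sum_range_succ, hf N le_rfl, hf (N + 1) (Nat.le_succ N), laguerreOp]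
    · rw [Finset.sum_range_succ' _ (N + 1), Finset.sum_range_succ]
      simp [shiftSeq, hf N le_rfl, add_mul, Finset.sum_add_distrib]
  · rw [Finset.sum_range_succ' _ (N + 1), Finset.sum_range_succ' _ N]
    simp [shiftSeq]

theorem coeff_laguerreOp {f : Polynomial ℂ} {k : ℕ} (α : ℝ) (hf : f.coeff (k + 1) = 0) :
    (laguerreOp α f).coeff k = -(k * f.coeff k) := by
  cases k with
  | zero => simp_all [laguerreOp, sub_mul, coeff_derivative]
  | succ k =>
    simp only [laguerreOp, sub_mul, coeff_add, coeff_sub, coeff_X_mul, coeff_C_mul,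
      coeff_derivative, hf]
    push_cast
    ring

theorem coeff_laguerreCoeffs_succ (α : ℝ) (f : ℕ → Polynomial ℂ)
    (hf : ∀ j k, j < k → (f j).coeff k = 0) {j k : ℕ} (h : j ≤ k) :
    (laguerreCoeffs α f (j + 1)).coeff (k + 1)
      = -((k + 1 : ℕ) * (f (j + 1)).coeff (k + 1)) - (f j).coeff k := by
  have h1 : (f j).coeff (k + 1) = 0 := hf _ _ (by omega)
  have h2 : (shiftSeq (fun i => X * f i) j).coeff (k + 1) = 0 := by
    cases j with
    | zero => simp [shiftSeq]
    | succ j => simpa [shiftSeq, coeff_X_mul] using hf j k (by omega)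
  simp only [laguerreCoeffs, coeff_add, coeff_laguerreOp α (hf (j + 1) (k + 1 + 1) (by omega))]
  rw [shiftSeq, shiftSeq, h2, two_mul]
  simp only [sub_mul, coeff_add, coeff_sub, coeff_X_mul, coeff_C_mul, coeff_derivative, h1]
  ring

theorem coeff_laguerreCoeffs_zero (α : ℝ) (f : ℕ → Polynomial ℂ)
    (hf : ∀ j k, j < k → (f j).coeff k = 0) (k : ℕ) :
    (laguerreCoeffs α f 0).coeff k = -(k * (f 0).coeff k) := by
  simp [laguerreCoeffs, shiftSeq, coeff_laguerreOp α (hf 0 (k + 1) (by omega))]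

theorem exists_laguerreOp_iterate_coeffs (α : ℝ) (m : ℕ) :
    ∃ f : ℕ → Polynomial ℂ,
      (∀ p : Polynomial ℂ,
        (laguerreOp α)^[m] p
          = ∑ j ∈ Finset.range (2 * m + 1),
              f j * (fun q : Polynomial ℂ => derivative q)^[j] p) ∧
      f (2 * m) = X ^ m ∧
      (∀ j, 2 * m + 1 ≤ j → f j = 0) ∧
      (∀ j k, j < k → (f j).coeff k = 0) ∧
      (∀ j, m < j → (f j).coeff j = 0) ∧
      (f m).coeff m = (-1) ^ m := by
  induction m with
  | zero =>
    refine ⟨fun j => if j = 0 then 1 else 0, by simp, by simp, ?_, ?_, ?_, by simp⟩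
    · intro j hj
      simp [show j ≠ 0 by omega]
    · intro j k hjk
      by_cases hj : j = 0 <;> simp [hj, coeff_one, show k ≠ 0 by omega]
    · intro j hj
      simp [show j ≠ 0 by omega]
  | succ m ih =>
    obtain ⟨f, hsum, htop, hzero, hdeg, hlow, hmid⟩ := ih
    refine ⟨laguerreCoeffs α f, ?_, ?_, ?_, ?_, ?_, ?_⟩
    · intro p
      rw [Function.iterate_succ_apply', hsum,
        laguerreOp_sum_mul α f (fun j => (fun q : Polynomial ℂ => derivative q)^[j] p) _
          (fun j => (Function.iterate_succ_apply' _ _ _).symm) hzero]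
      rfl
    · change laguerreCoeffs α f (2 * m + 2) = _
      simp [laguerreCoeffs, shiftSeq, laguerreOp, htop, hzero (2 * m + 1) le_rfl,
        hzero (2 * m + 2) (by omega), pow_succ']
    · intro j hj
      obtain ⟨i, rfl⟩ : ∃ i, j = i + 2 := ⟨j - 2, by omega⟩
      simp [laguerreCoeffs, shiftSeq, laguerreOp, hzero i (by omega), hzero (i + 1) (by omega),
        hzero (i + 2) (by omega)]
    · intro j k hjk
      cases j with
      | zero => simp [coeff_laguerreCoeffs_zero α f hdeg, hdeg 0 k hjk]
      | succ j =>
        obtain ⟨k, rfl⟩ : ∃ i, k = i + 1 := ⟨k - 1, by omega⟩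
        rw [coeff_laguerreCoeffs_succ α f hdeg (by omega), hdeg _ _ hjk,
          hdeg j k (by omega)]
        simp
    · intro j hj
      obtain ⟨j, rfl⟩ : ∃ i, j = i + 1 := ⟨j - 1, by omega⟩
      rw [coeff_laguerreCoeffs_succ α f hdeg le_rfl, hlow _ (by omega), hlow j (by omega)]
      simp
    · rw [coeff_laguerreCoeffs_succ α f hdeg le_rfl, hlow _ (by omega), hmid]
      ring

/-- the `m`-fold power of the Laguerre operator `δ` has coefficients
`f_0, …, f_{2m}` with `f_{2m} = Xᵐ`, `deg f_j < j` for `m+1 ≤ j ≤ 2m`, and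
`f_m = (−1)ᵐ Xᵐ` plus lower-order terms. -/
theorem stmt16 (α : ℝ) (m : ℕ) (hm : 1 ≤ m) :
    ∃ f : ℕ → Polynomial ℂ,
      (∀ p : Polynomial ℂ,
        (laguerreOp α)^[m] p
          = ∑ j ∈ Finset.range (2 * m + 1),
              f j * (fun q : Polynomial ℂ => derivative q)^[j] p) ∧
      f (2 * m) = X ^ m ∧
      (∀ j, m + 1 ≤ j → j ≤ 2 * m → (f j).degree < (j : WithBot ℕ)) ∧
      (f m - C ((-1 : ℂ)) ^ m * X ^ m).degree < (m : WithBot ℕ) := by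
  obtain ⟨f, hsum, htop, -, hdeg, hlow, hmid⟩ := exists_laguerreOp_iterate_coeffs α m
  refine ⟨f, hsum, htop, fun j hj _ => ?_, ?_⟩
  · rw [degree_lt_iff_coeff_zero]
    intro k hk
    rcases hk.eq_or_lt with rfl | hk
    · exact hlow _ hj
    · exact hdeg _ _ hk
  · rw [degree_lt_iff_coeff_zero]
    intro k hk
    rw [← C_pow, coeff_sub, coeff_C_mul, coeff_X_pow]
    rcases hk.eq_or_lt with rfl | hk
    · simp [hmid]
    · simp [hdeg _ _ hk, hk.ne']
end
end
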